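/- There is a weakly 2-random Turing degree which bounds a minimal Turing degree. -/

import Mathlib

/-
Common framework: oracle (relative) partial computability via codes,
Turing reducibility, the jump, Cantor-space measure, Martin-Löf randomness
and genericity relative to an oracle, Turing functionals.
-/

open scoped ENNReal

namespace TypicalDegree

/-- Codes for partial functions recursive in an oracle (Kleene-style),
    following `Nat.Partrec.Code` with an extra `oracle` constructor. -/
inductive OracleCode : Type
  | zero : OracleCode
  | succ : OracleCode
  | left : OracleCode
  | right : OracleCode
  | oracle : OracleCode
  | pair : OracleCode → OracleCode → OracleCode
  | comp : OracleCode → OracleCode → OracleCode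
  | prec : OracleCode → OracleCode → OracleCode
  | rfind' : OracleCode → OracleCode

/-- Evaluation of an oracle code relative to an oracle `g : ℕ →. ℕ`. -/
def OracleCode.eval (g : ℕ →. ℕ) : OracleCode → ℕ →. ℕ
  | .zero => pure 0
  | .succ => Nat.succ
  | .left => ↑fun n : ℕ => n.unpair.1
  | .right => ↑fun n : ℕ => n.unpair.2
  | .oracle => g
  | .pair cf cg => fun n => Nat.pair <$> OracleCode.eval g cf n <*> OracleCode.eval g cg n
  | .comp cf cg => fun n => OracleCode.eval g cg n >>= OracleCode.eval g cf
  | .prec cf cg =>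
    Nat.unpaired fun a n =>
      n.rec (OracleCode.eval g cf a) fun y IH => do
        let i ← IH
        OracleCode.eval g cg (Nat.pair a (Nat.pair y i))
  | .rfind' cf =>
    Nat.unpaired fun a m =>
      (Nat.rfind fun n => (fun m => m = 0) <$> OracleCode.eval g cf (Nat.pair a (n + m))).map
        (· + m)

/-- An effective injective numbering of oracle codes. -/
def OracleCode.encodeCode : OracleCode → ℕ
  | .zero => 0
  | .succ => 1
  | .left => 2
  | .right => 3
  | .oracle => 4
  | .pair cf cg => 4 * Nat.pair cf.encodeCode cg.encodeCode + 5
  | .comp cf cg => 4 * Nat.pair cf.encodeCode cg.encodeCode + 6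
  | .prec cf cg => 4 * Nat.pair cf.encodeCode cg.encodeCode + 7
  | .rfind' cf => 4 * Nat.pair cf.encodeCode cf.encodeCode + 8

/-- The characteristic (total) oracle of an element of Cantor space. -/
def chi (X : ℕ → Bool) : ℕ →. ℕ := fun n => Part.some (cond (X n) 1 0)

/-- `f` is partial recursive relative to the oracle `g`. -/
def RedIn (f g : ℕ →. ℕ) : Prop := ∃ c : OracleCode, c.eval g = f

/-- A total function `ℕ → ℕ` viewed as a partial function. -/
def natFun (f : ℕ → ℕ) : ℕ →. ℕ := fun n => Part.some (f n)

/-- Turing reducibility between elements of Cantor space. -/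
def TRed (X Y : ℕ → Bool) : Prop := RedIn (chi X) (chi Y)

/-- Turing equivalence. -/
def TEquiv (X Y : ℕ → Bool) : Prop := TRed X Y ∧ TRed Y X

/-- `X` is computable. -/
def ComputableSeq (X : ℕ → Bool) : Prop := TRed X fun _ => false

/-- `f : ℕ → ℕ` is computable. -/
def ComputableFun (f : ℕ → ℕ) : Prop := RedIn (natFun f) (chi fun _ => false)

/-- The Turing jump of `X`: the halting problem relative to `X`,
    under the numbering `encodeCode`. -/
noncomputable def jump (X : ℕ → Bool) : ℕ → Bool := fun n =>
  @decide (∃ c : OracleCode, c.encodeCode = n ∧ (c.eval (chi X) n).Dom) (Classical.dec _)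

/-- `∅'`, the halting problem. -/
noncomputable def zeroJump : ℕ → Bool := jump fun _ => false

/-- `X` extends the finite binary string `σ` (i.e. `σ ⊂ X`). -/
def extendsStr (X : ℕ → Bool) (σ : List Bool) : Prop :=
  ∀ i : Fin σ.length, X i.1 = σ.get i

/-- `⟦V⟧`: the open set of infinite sequences extending some string in `V`. -/
def openOf (V : Set (List Bool)) : Set (ℕ → Bool) := {X | ∃ σ ∈ V, extendsStr X σ}

/-- The (fair-coin) measure of the open set `⟦V⟧` determined by a set of strings `V`:
    the supremum over `n` of the proportion of length-`n` strings with a prefix in `V`. -/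
noncomputable def stringMeasure (V : Set (List Bool)) : ℝ≥0∞ :=
  ⨆ n : ℕ, (Nat.card {f : Fin n → Bool // ∃ σ ∈ V, σ <+: List.ofFn f} : ℝ≥0∞) / 2 ^ n

/-- The fair-coin (Lebesgue) measure on Cantor space, as the outer measure obtained from
    open coverings by sets of strings; it agrees with Lebesgue measure on measurable sets. -/
noncomputable def cantorMeasure (S : Set (ℕ → Bool)) : ℝ≥0∞ :=
  ⨅ (V : Set (List Bool)) (_ : S ⊆ openOf V), stringMeasure V

/-- `W` is computably enumerable relative to `X`. -/
def CEIn (X : ℕ → Bool) (W : Set (List Bool)) : Prop :=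
  ∃ c : OracleCode, ∀ σ : List Bool, σ ∈ W ↔ (c.eval (chi X) (Encodable.encode σ)).Dom

/-- `W` is computably enumerable. -/
def CE (W : Set (List Bool)) : Prop := CEIn (fun _ => false) W

/-- The c.e. set of strings with index `d`. -/
def ceSetOf (d : OracleCode) : Set (List Bool) :=
  {σ | (d.eval (chi fun _ => false) (Encodable.encode σ)).Dom}

/-- The sequence `V` of sets of strings is uniformly c.e. relative to `X`. -/
def UniformCEIn (X : ℕ → Bool) (V : ℕ → Set (List Bool)) : Prop :=
  ∃ c : OracleCode, ∀ (i : ℕ) (σ : List Bool),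
    σ ∈ V i ↔ (c.eval (chi X) (Nat.pair i (Encodable.encode σ))).Dom

/-- A Martin-Löf test relative to `X`. -/
def MLTest (X : ℕ → Bool) (V : ℕ → Set (List Bool)) : Prop :=
  UniformCEIn X V ∧ ∀ i : ℕ, stringMeasure (V i) < (2 : ℝ≥0∞)⁻¹ ^ i

/-- `Y` is Martin-Löf random relative to `X`. -/
def MLRandomIn (X Y : ℕ → Bool) : Prop :=
  ∀ V : ℕ → Set (List Bool), MLTest X V → ∃ i, Y ∉ openOf (V i)

/-- `Y` is 1-random. -/
def OneRandom (Y : ℕ → Bool) : Prop := MLRandomIn (fun _ => false) Y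

/-- `Y` is 2-random: Martin-Löf random relative to `∅'`. -/
def TwoRandom (Y : ℕ → Bool) : Prop := MLRandomIn zeroJump Y

/-- `Y` is weakly 2-random: it avoids every null `Π⁰₂` class
    (every null intersection of a uniformly c.e. sequence of open sets). -/
def Weak2Random (Y : ℕ → Bool) : Prop :=
  ∀ V : ℕ → Set (List Bool), UniformCEIn (fun _ => false) V →
    cantorMeasure (⋂ i, openOf (V i)) = 0 → Y ∉ ⋂ i, openOf (V i)

/-- `Y` is 1-generic relative to `X`. -/
def OneGenericIn (X Y : ℕ → Bool) : Prop :=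
  ∀ W : Set (List Bool), CEIn X W →
    ∃ σ : List Bool, extendsStr Y σ ∧ (σ ∈ W ∨ ∀ τ : List Bool, σ <+: τ → τ ∉ W)

/-- `Y` is 1-generic. -/
def OneGeneric (Y : ℕ → Bool) : Prop := OneGenericIn (fun _ => false) Y

/-- `Y` is 2-generic: 1-generic relative to `∅'`. -/
def TwoGeneric (Y : ℕ → Bool) : Prop := OneGenericIn zeroJump Y

/-- The Turing functional coded by `c` is total on oracle `X` with value `Y ∈ 2^ω`
    (i.e. `Ψ^X = Y`). -/
def FTotal (c : OracleCode) (X : ℕ → Bool) (Y : ℕ → Bool) : Prop :=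
  c.eval (chi X) = chi Y

/-- `Ψ^X ⊇ σ`: the output of the functional `c` on oracle `X` extends the string `σ`. -/
def FExtends (c : OracleCode) (X : ℕ → Bool) (σ : List Bool) : Prop :=
  ∀ i : Fin σ.length, c.eval (chi X) i.1 = Part.some (cond (σ.get i) 1 0)

/-- `π(Ψ,σ) = μ({X : Ψ^X ⊇ σ})`. -/
noncomputable def piMeasure (c : OracleCode) (σ : List Bool) : ℝ≥0∞ :=
  cantorMeasure {X | FExtends c X σ}

/-- A Turing functional is special if every infinite binary sequence
    in its range is incomputable. -/
def Special (c : OracleCode) : Prop :=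
  ∀ X Y : ℕ → Bool, FTotal c X Y → ¬ ComputableSeq Y

/-- The code `c` computes the total function `T` on strings (no oracle). -/
def ComputesFun (c : OracleCode) (T : List Bool → Bool) : Prop :=
  ∀ σ : List Bool, c.eval (chi fun _ => false) (Encodable.encode σ) = Part.some (cond (T σ) 1 0)

/-- `T` is (the characteristic function of) a tree: closed under prefixes. -/
def IsTree (T : List Bool → Bool) : Prop :=
  ∀ σ τ : List Bool, σ <+: τ → T τ = true → T σ = true

/-- The set of infinite paths through the tree `T`; `Π⁰₁` classes are the
    sets of paths through computable trees. -/
def pathsOf (T : List Bool → Bool) : Set (ℕ → Bool) :=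
  {X | ∀ n : ℕ, T (List.ofFn fun i : Fin n => X i.1) = true}

/-- The computable join `X ⊕ Y`. -/
def join (X Y : ℕ → Bool) : ℕ → Bool := fun n =>
  if n % 2 = 0 then X (n / 2) else Y (n / 2)

/-- A finite string used as a (partial) oracle. -/
def strOracle (τ : List Bool) : ℕ →. ℕ := fun n =>
  if h : n < τ.length then Part.some (cond (τ.get ⟨n, h⟩) 1 0) else Part.none

/-- `Ψ^{τ₀}` and `Ψ^{τ₁}` are incompatible: they give different outputs somewhere. -/
def SplitPair (c : OracleCode) (τ₀ τ₁ : List Bool) : Prop :=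
  ∃ (n v₀ v₁ : ℕ), v₀ ∈ c.eval (strOracle τ₀) n ∧ v₁ ∈ c.eval (strOracle τ₁) n ∧ v₀ ≠ v₁

/-- `(U,V)` is a `Ψ`-splitting above `τ`. -/
def SplittingAbove (c : OracleCode) (τ : List Bool) (U V : Finset (List Bool)) : Prop :=
  (∃ ℓ : ℕ, ∀ σ ∈ U ∪ V, σ.length = ℓ ∧ τ <+: σ) ∧
    ∀ σ₀ ∈ U, ∀ σ₁ ∈ V, SplitPair c σ₀ σ₁

/-- The output sequence `Ψ^X` of the functional `c` on oracle `X`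
    (defaults to `false` when not total). -/
noncomputable def outSeq (c : OracleCode) (X : ℕ → Bool) : ℕ → Bool := fun n =>
  @dite _ (∃ Y : ℕ → Bool, FTotal c X Y) (Classical.dec _) (fun h => h.choose n) fun _ => false

/-- `Ψ^X ↾ n`, as a finite string. -/
noncomputable def outStr (c : OracleCode) (X : ℕ → Bool) (n : ℕ) : List Bool :=
  List.ofFn fun i : Fin n => outSeq c X i.1

/-- The degree of `M` is a minimal Turing degree. -/
def MinimalDeg (M : ℕ → Bool) : Prop :=
  ¬ ComputableSeq M ∧ ∀ Z : ℕ → Bool, TRed Z M → ComputableSeq Z ∨ TRed M Z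


section Construction

/-! ### Oracle computability -/

/-- The prefix of length `s`. -/
def pre (X : ℕ → Bool) (s : ℕ) : List Bool := (List.range s).map X

theorem eval_partrec {α : Type} [Primcodable α] (g : α → ℕ →. ℕ) (hg : Partrec₂ g)
    (c : OracleCode) : Partrec₂ (fun a n => c.eval (g a) n) := by
  induction c with
  | zero => exact (Computable.const 0).partrec
  | succ => exact (Computable.succ.comp Computable.snd).partrec
  | left => exact (Computable.fst.comp (Computable.unpair.comp Computable.snd)).partrec
  | right => exact (Computable.snd.comp (Computable.unpair.comp Computable.snd)).partrec
  | oracle => exact hg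
  | pair cf cg hf hg' =>
    have : Partrec fun x : α × ℕ => (cf.eval (g x.1) x.2).bind fun u =>
        (cg.eval (g x.1) x.2).map fun v => Nat.pair u v := by
      refine Partrec.bind hf ?_
      refine Partrec.map (f := fun y : (α × ℕ) × ℕ => cg.eval (g y.1.1) y.1.2)
        (hg'.comp (Computable.fst.comp Computable.fst) (Computable.snd.comp Computable.fst)) ?_
      exact (Primrec₂.natPair.to_comp.comp (Computable.snd.comp Computable.fst) Computable.snd)
    refine this.of_eq fun x => ?_
    simp [OracleCode.eval, Seq.seq]
  | comp cf cg hf hg' =>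
    have : Partrec fun x : α × ℕ => (cg.eval (g x.1) x.2).bind fun u => cf.eval (g x.1) u :=
      Partrec.bind hg' (hf.comp (Computable.fst.comp Computable.fst) Computable.snd)
    exact this
  | prec cf cg hf hg' =>
    have : Partrec fun x : α × ℕ => Nat.rec (cf.eval (g x.1) x.2.unpair.1)
       (fun y IH => IH.bind fun i => cg.eval (g x.1) (Nat.pair x.2.unpair.1 (Nat.pair y i)))
         x.2.unpair.2 := by
      refine Partrec.nat_rec (f := fun x : α × ℕ => x.2.unpair.2)
        (g := fun x : α × ℕ => cf.eval (g x.1) x.2.unpair.1)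
        (h := fun (x : α × ℕ) (y : ℕ × ℕ) =>
          cg.eval (g x.1) (Nat.pair x.2.unpair.1 (Nat.pair y.1 y.2))) ?_ ?_ ?_
      · exact (Computable.snd.comp (Computable.unpair.comp Computable.snd))
      · exact hf.comp Computable.fst
          (Computable.fst.comp (Computable.unpair.comp Computable.snd))
      · refine hg'.comp (Computable.fst.comp Computable.fst) ?_
        refine Primrec₂.natPair.to_comp.comp (Computable.fst.comp (Computable.unpair.comp
          (Computable.snd.comp Computable.fst))) ?_
        exact Primrec₂.natPair.to_comp.comp (Computable.fst.comp Computable.snd)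
          (Computable.snd.comp Computable.snd)
    exact this
  | rfind' cf hf =>
    have : Partrec fun x : α × ℕ => (Nat.rfind fun n => (fun m => decide (m = 0)) <$>
       cf.eval (g x.1) (Nat.pair x.2.unpair.1 (n + x.2.unpair.2))).map (· + x.2.unpair.2) := by
      refine Partrec.map ?_ ?_
      · refine Partrec.rfind (p := fun (x : α × ℕ) n => (fun m => decide (m = 0)) <$>
           cf.eval (g x.1) (Nat.pair x.2.unpair.1 (n + x.2.unpair.2))) ?_
        refine Partrec.map (f := fun y : (α × ℕ) × ℕ =>
          cf.eval (g y.1.1) (Nat.pair y.1.2.unpair.1 (y.2 + y.1.2.unpair.2)))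
          (g := fun _ m => decide (m = 0)) ?_ ?_
        · refine hf.comp (Computable.fst.comp Computable.fst) ?_
          refine Primrec₂.natPair.to_comp.comp (Computable.fst.comp (Computable.unpair.comp
            (Computable.snd.comp Computable.fst))) ?_
          exact Primrec.nat_add.to_comp.comp Computable.snd (Computable.snd.comp
            (Computable.unpair.comp (Computable.snd.comp Computable.fst)))
        · have h : PrimrecPred fun m : ℕ => m = 0 :=
            Primrec.eq.comp Primrec.id (Primrec.const 0)
          exact (h.decide.to_comp.comp Computable.snd)
      · exact Primrec.nat_add.to_comp.comp Computable.snd (Computable.snd.comp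
            (Computable.unpair.comp (Computable.snd.comp Computable.fst)))
    exact this

theorem mem_rfind'_eval (g : ℕ →. ℕ) (cf : OracleCode) (n v : ℕ) :
    v ∈ (OracleCode.rfind' cf).eval g n ↔ ∃ w, (0 ∈ cf.eval g (Nat.pair n.unpair.1 (w + n.unpair.2))
      ∧ ∀ i < w, ∃ y ∈ cf.eval g (Nat.pair n.unpair.1 (i + n.unpair.2)), y ≠ 0) ∧
      w + n.unpair.2 = v := by
  have : (OracleCode.rfind' cf).eval g n = (Nat.rfind fun k => (fun m => decide (m = 0)) <$>
       cf.eval g (Nat.pair n.unpair.1 (k + n.unpair.2))).map (· + n.unpair.2) := rfl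
  rw [this, Part.mem_map_iff]
  refine exists_congr fun w => and_congr_left fun _ => ?_
  refine Nat.mem_rfind.trans ?_
  refine and_congr ?_ ⟨fun h i hi => ?_, fun h i hi => ?_⟩
  · refine (Part.mem_map_iff _).trans ?_
    simp
  · simpa using (Part.mem_map_iff _).1 (h hi)
  · obtain ⟨y, hy, h0⟩ := h i hi
    exact (Part.mem_map_iff _).2 ⟨y, hy, by simpa using h0⟩

theorem eval_compact (G : ℕ → ℕ →. ℕ) (g : ℕ →. ℕ)
    (hm : ∀ i j, i ≤ j → ∀ n v, v ∈ G i n → v ∈ G j n)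
    (hg : ∀ n v, v ∈ g n → ∃ k, v ∈ G k n) (c : OracleCode) :
    ∀ n v, v ∈ c.eval g n → ∃ k, ∀ j, k ≤ j → v ∈ c.eval (G j) n := by
  induction c with
  | zero => intro n v h; exact ⟨0, fun _ _ => h⟩
  | succ => intro n v h; exact ⟨0, fun _ _ => h⟩
  | left => intro n v h; exact ⟨0, fun _ _ => h⟩
  | right => intro n v h; exact ⟨0, fun _ _ => h⟩
  | oracle =>
    intro n v h
    obtain ⟨k, hk⟩ := hg n v h
    exact ⟨k, fun j hj => hm k j hj n v hk⟩
  | pair cf cg hf hg' =>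
    intro n v h
    simp only [OracleCode.eval, Seq.seq, Part.mem_bind_iff, Part.map_eq_map, Part.mem_map_iff]
      at h ⊢
    obtain ⟨f, ⟨a, ha, rfl⟩, b, hb, rfl⟩ := h
    obtain ⟨k1, h1⟩ := hf n a ha
    obtain ⟨k2, h2⟩ := hg' n b hb
    exact ⟨max k1 k2, fun j hj => ⟨_, ⟨a, h1 j (by omega), rfl⟩, b, h2 j (by omega), rfl⟩⟩
  | comp cf cg hf hg' =>
    intro n v h
    obtain ⟨a, ha, hb⟩ := Part.mem_bind_iff.1 (show v ∈ (cg.eval g n).bind (cf.eval g) from h)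
    obtain ⟨k1, h1⟩ := hg' n a ha
    obtain ⟨k2, h2⟩ := hf a v hb
    exact ⟨max k1 k2, fun j hj =>
      Part.mem_bind_iff.2 ⟨a, h1 j (by omega), h2 j (by omega)⟩⟩
  | prec cf cg hf hg' =>
    intro n v h
    simp only [OracleCode.eval, Nat.unpaired] at h ⊢
    generalize n.unpair.1 = a at *
    generalize n.unpair.2 = m at *
    induction m generalizing v with
    | zero => exact hf a v h
    | succ m ih =>
      simp only [Part.bind_eq_bind, Part.mem_bind_iff] at h ⊢
      obtain ⟨u, hu, hb⟩ := h
      obtain ⟨k1, h1⟩ := ih u hu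
      obtain ⟨k2, h2⟩ := hg' _ v hb
      exact ⟨max k1 k2, fun j hj => ⟨u, h1 j (by omega), h2 j (by omega)⟩⟩
  | rfind' cf hf =>
    intro n v h
    rw [mem_rfind'_eval] at h
    simp only [mem_rfind'_eval]
    generalize n.unpair.1 = a at *
    generalize n.unpair.2 = m at *
    obtain ⟨w, ⟨hx, hlt⟩, rfl⟩ := h
    obtain ⟨k1, h1⟩ := hf _ _ hx
    have : ∀ N ≤ w, ∃ k, ∀ j, k ≤ j → ∀ {i : ℕ}, i < N →
        ∃ y ∈ cf.eval (G j) (Nat.pair a (i + m)), y ≠ 0 := by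
      intro N
      induction N with
      | zero => intro _; exact ⟨0, fun j _ i hi => by omega⟩
      | succ N ih =>
        intro hN
        obtain ⟨k, hk⟩ := ih (by omega)
        obtain ⟨y, hy, hy0⟩ := hlt N (by omega)
        obtain ⟨k', hk'⟩ := hf _ y hy
        refine ⟨max k k', fun j hj i hi => ?_⟩
        rcases Nat.lt_succ_iff_lt_or_eq.1 hi with h | rfl
        · exact hk j (by omega) h
        · exact ⟨y, hk' j (by omega), hy0⟩
    obtain ⟨k2, h2⟩ := this w le_rfl
    exact ⟨max k1 k2, fun j hj => ⟨w, ⟨h1 j (by omega), fun i hi => h2 j (by omega) hi⟩, rfl⟩⟩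

theorem eval_mono {g g' : ℕ →. ℕ} (h : ∀ n v, v ∈ g n → v ∈ g' n) (c : OracleCode) (n v : ℕ)
    (hv : v ∈ c.eval g n) : v ∈ c.eval g' n := by
  obtain ⟨k, hk⟩ := eval_compact (fun _ => g') g (fun _ _ _ _ _ h => h)
    (fun n v hv => ⟨0, h n v hv⟩) c n v hv
  exact hk k le_rfl

/-! ### Closure properties of `RedIn` -/

theorem RedIn.of_partrec {f : ℕ →. ℕ} (hf : Nat.Partrec f) (g : ℕ →. ℕ) : RedIn f g := by
  induction hf with
  | zero => exact ⟨.zero, rfl⟩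
  | succ => exact ⟨.succ, rfl⟩
  | left => exact ⟨.left, rfl⟩
  | right => exact ⟨.right, rfl⟩
  | pair _ _ h1 h2 =>
    obtain ⟨c1, rfl⟩ := h1
    obtain ⟨c2, rfl⟩ := h2
    exact ⟨.pair c1 c2, rfl⟩
  | comp _ _ h1 h2 =>
    obtain ⟨c1, rfl⟩ := h1
    obtain ⟨c2, rfl⟩ := h2
    exact ⟨.comp c1 c2, rfl⟩
  | prec _ _ h1 h2 =>
    obtain ⟨c1, rfl⟩ := h1
    obtain ⟨c2, rfl⟩ := h2
    exact ⟨.prec c1 c2, rfl⟩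
  | rfind _ h1 =>
    obtain ⟨c1, rfl⟩ := h1
    refine ⟨.comp (.rfind' c1) (.pair (.pair .left .right) .zero), ?_⟩
    funext n
    simp [OracleCode.eval, Seq.seq, pure, PFun.pure]
    exact Part.map_id' (fun _ => rfl) _

theorem RedIn.oracle (g : ℕ →. ℕ) : RedIn g g := ⟨.oracle, rfl⟩

theorem RedIn.comp {f h g : ℕ →. ℕ} (hf : RedIn f g) (hh : RedIn h g) :
    RedIn (fun n => (h n).bind f) g := by
  obtain ⟨c1, rfl⟩ := hf
  obtain ⟨c2, rfl⟩ := hh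
  exact ⟨.comp c1 c2, rfl⟩

theorem RedIn.pair {f h : ℕ → ℕ} {g : ℕ →. ℕ} (hf : RedIn (fun n => Part.some (f n)) g)
    (hh : RedIn (fun n => Part.some (h n)) g) :
    RedIn (fun n => Part.some (Nat.pair (f n) (h n))) g := by
  obtain ⟨c1, h1⟩ := hf
  obtain ⟨c2, h2⟩ := hh
  refine ⟨.pair c1 c2, ?_⟩
  funext n
  simp [OracleCode.eval, Seq.seq, h1, h2]

theorem RedIn.comp' {f h : ℕ → ℕ} {g : ℕ →. ℕ} (hf : RedIn (fun n => Part.some (f n)) g)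
    (hh : RedIn (fun n => Part.some (h n)) g) :
    RedIn (fun n => Part.some (f (h n))) g := by
  simpa using RedIn.comp hf hh

theorem RedIn.of_computable {f : ℕ → ℕ} (hf : Computable f) (g : ℕ →. ℕ) :
    RedIn (fun n => Part.some (f n)) g :=
  RedIn.of_partrec (Partrec.nat_iff.1 hf.partrec) g

theorem RedIn.prec0 {a : ℕ} {f : ℕ → ℕ} {h : ℕ → ℕ} {g : ℕ →. ℕ}
    (hh : RedIn (fun n => Part.some (h n)) g) (h0 : f 0 = a)
    (hs : ∀ n, f (n + 1) = h (Nat.pair n (f n))) : RedIn (fun n => Part.some (f n)) g := by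
  have h1 : RedIn (fun n => Part.some (h n.unpair.2)) g :=
    RedIn.comp' hh (RedIn.of_computable (Computable.snd.comp Computable.unpair) g)
  have h2 : RedIn (fun n => Part.some a) g := RedIn.of_computable (Computable.const a) g
  obtain ⟨c1, h1⟩ := h1
  obtain ⟨c2, h2⟩ := h2
  refine ⟨.comp (.prec c2 c1) (.pair .zero (.pair .left .right)), ?_⟩
  funext n
  simp only [OracleCode.eval, Seq.seq, h1, h2]
  simp [pure, PFun.pure]
  induction n with
  | zero => simp [h0]
  | succ n ih =>
    refine (congrArg (fun p : Part ℕ => p.bind fun i => Part.some (h (Nat.pair n i))) ih).trans ?_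
    simp [hs]

theorem RedIn.rfind0 {f : ℕ → ℕ} {h : ℕ → ℕ} {g : ℕ →. ℕ}
    (hh : RedIn (fun n => Part.some (h n)) g)
    (hf : ∀ n, h (Nat.pair n (f n)) = 0 ∧ ∀ m < f n, h (Nat.pair n m) ≠ 0) :
    RedIn (fun n => Part.some (f n)) g := by
  obtain ⟨c1, h1⟩ := hh
  refine ⟨.comp (.rfind' c1) (.pair (.pair .left .right) .zero), ?_⟩
  funext n
  simp only [OracleCode.eval, Seq.seq, h1]
  simp [pure, PFun.pure]
  refine Part.eq_some_iff.2 ?_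
  refine Nat.mem_rfind.2 ⟨?_, fun {m} hm => ?_⟩
  · simpa using (hf n).1
  · simpa using (hf n).2 m hm

@[simp] theorem pre_length (X : ℕ → Bool) (s : ℕ) : (pre X s).length = s := by simp [pre]

theorem pre_succ (X : ℕ → Bool) (s : ℕ) : pre X (s+1) = pre X s ++ [X s] := by
  simp [pre, List.range_succ]

theorem prefixRed (A : ℕ → Bool) :
    RedIn (fun s => Part.some (Encodable.encode (pre A s))) (chi A) := by
  have hA : RedIn (fun n => Part.some (cond (A n) 1 0)) (chi A) := RedIn.oracle _
  have hl : RedIn (fun n => Part.some n.unpair.1) (chi A) :=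
    RedIn.of_computable (Computable.fst.comp Computable.unpair) _
  have hr : RedIn (fun n => Part.some n.unpair.2) (chi A) :=
    RedIn.of_computable (Computable.snd.comp Computable.unpair) _
  let k : ℕ → ℕ := fun n => Encodable.encode
    (((Encodable.decode (α := List Bool) n.unpair.2).getD []) ++ [decide (n.unpair.1 = 1)])
  have hk : Computable k := by
    refine Primrec.to_comp (Primrec.encode.comp ?_)
    refine Primrec.list_append.comp (Primrec.option_getD.comp (Primrec.decode.comp
      (Primrec.snd.comp Primrec.unpair)) (Primrec.const [])) ?_
    refine Primrec.list_cons.comp ?_ (Primrec.const [])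
    have : PrimrecPred fun n : ℕ => n.unpair.1 = 1 :=
      Primrec.eq.comp (Primrec.fst.comp Primrec.unpair) (Primrec.const 1)
    exact this.decide
  have h1 := RedIn.comp' (RedIn.of_computable hk (chi A)) (RedIn.pair (RedIn.comp' hA hl) hr)
  refine RedIn.prec0 (f := fun s => Encodable.encode (pre A s)) h1 rfl ?_
  intro n
  simp only [k, Nat.unpair_pair, Encodable.encodek, pre_succ]
  cases A n <;> simp

/-- `M` is computed from `A` by a computable list functional. -/
theorem TRed_of_list {A M : ℕ → Bool} (F : List Bool → List Bool) (hF : Computable F)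
    (h1 : ∀ s i b, (F (pre A s))[i]? = some b → M i = b)
    (h2 : ∀ n, ∃ s, n < (F (pre A s)).length) : TRed M A := by
  classical
  have hl : RedIn (fun n => Part.some n.unpair.1) (chi A) :=
    RedIn.of_computable (Computable.fst.comp Computable.unpair) _
  have hr : RedIn (fun n => Part.some n.unpair.2) (chi A) :=
    RedIn.of_computable (Computable.snd.comp Computable.unpair) _
  let q : ℕ → Option Bool := fun n =>
    (F ((Encodable.decode (α := List Bool) n.unpair.2).getD []))[n.unpair.1]?
  have hq : Computable q := by
    refine Primrec.list_getElem?.to_comp.comp (hF.comp ?_)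
      (Computable.fst.comp Computable.unpair)
    exact (Primrec.option_getD.comp (Primrec.decode.comp
      (Primrec.snd.comp Primrec.unpair)) (Primrec.const [])).to_comp
  let k : ℕ → ℕ := fun n => (q n).casesOn 1 (fun _ => 0)
  have hk : Computable k :=
    Computable.option_casesOn hq (Computable.const 1) (Computable.const 0).to₂
  let k2 : ℕ → ℕ := fun n => (q n).casesOn 0 (fun b => cond b 1 0)
  have hk2 : Computable k2 :=
    Computable.option_casesOn hq (Computable.const 0)
      (Computable.cond Computable.snd (Computable.const 1) (Computable.const 0)).to₂
  have hp := RedIn.pair hl (RedIn.comp' (prefixRed A) hr)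
  have e1 := RedIn.comp' (RedIn.of_computable hk (chi A)) hp
  have hf := RedIn.rfind0 (f := fun n => Nat.find (h2 n)) e1 (by
    intro n
    have a := Nat.find_spec (h2 n)
    constructor
    · simp only [k, q, Nat.unpair_pair, Encodable.encodek, Option.getD_some]
      rw [List.getElem?_eq_getElem a]
    · intro m hm
      have b := Nat.find_min (h2 n) hm
      simp only [k, q, Nat.unpair_pair, Encodable.encodek, Option.getD_some]
      rw [List.getElem?_eq_none (by omega)]
      simp)
  have hid : RedIn (fun n => Part.some n) (chi A) := RedIn.of_computable Computable.id _
  have e2 := RedIn.comp' (RedIn.of_computable hk2 (chi A))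
    (RedIn.pair hid (RedIn.comp' (prefixRed A) hf))
  have e3 : chi M = fun n => Part.some (k2 (Nat.pair n (Encodable.encode
      (pre A (Nat.find (h2 n)))))) := by
    funext n
    have a := Nat.find_spec (h2 n)
    have b := h1 _ _ _ (List.getElem?_eq_getElem a)
    simp only [k2, q, Nat.unpair_pair, Encodable.encodek, Option.getD_some]
    rw [List.getElem?_eq_getElem a, ← b]
    rfl
  unfold TRed
  rw [e3]
  exact e2

theorem ComputableSeq.of_computable {Z : ℕ → Bool} (hZ : Computable Z) : ComputableSeq Z :=
  RedIn.of_computable (f := fun n => cond (Z n) 1 0)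
    (Computable.cond hZ (Computable.const 1) (Computable.const 0)) _

theorem chi_false_partrec : Partrec₂ (fun (_ : Unit) => chi fun _ => false) :=
  (Computable.const 0).partrec.to₂

theorem eval_false_partrec (c : OracleCode) : Partrec (c.eval (chi fun _ => false)) :=
  (eval_partrec (fun (_ : Unit) => chi fun _ => false) chi_false_partrec c).comp
    (Computable.const ()) Computable.id

theorem strOracle_partrec : Partrec₂ strOracle := by
  have : Computable fun x : List Bool × ℕ =>
      (x.1[x.2]?).map (fun b => cond b 1 0) :=
    Primrec.to_comp (Primrec.option_map Primrec.list_getElem?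
      (Primrec.cond Primrec.snd (Primrec.const 1) (Primrec.const 0)).to₂)
  refine (this.ofOption).of_eq fun x => ?_
  simp only [strOracle]
  split_ifs with h
  · rw [List.getElem?_eq_getElem h]; simp
  · rw [List.getElem?_eq_none (by omega)]; simp

theorem eval_str_partrec (c : OracleCode) : Partrec₂ (fun τ n => c.eval (strOracle τ) n) :=
  eval_partrec strOracle strOracle_partrec c

theorem ComputableSeq.computable {Z : ℕ → Bool} (h : ComputableSeq Z) : Computable Z := by
  obtain ⟨c, hc⟩ := h
  have := eval_false_partrec c
  rw [hc] at this
  have h2 : Computable fun n => (cond (Z n) 1 0 : ℕ) := this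
  have h3 : PrimrecPred fun n : ℕ => n = 1 := Primrec.eq.comp Primrec.id (Primrec.const 1)
  refine (h3.decide.to_comp.comp h2).of_eq fun n => ?_
  cases Z n <;> simp

theorem mem_strOracle {τ : List Bool} {n v : ℕ} :
    v ∈ strOracle τ n ↔ ∃ b, τ[n]? = some b ∧ v = cond b 1 0 := by
  simp only [strOracle]
  split_ifs with h
  · simp [List.getElem?_eq_getElem h]
  · simp [List.getElem?_eq_none (Nat.le_of_not_lt h)]

theorem eval_str_mono {τ τ' : List Bool} (h : τ <+: τ') (c : OracleCode) (n v : ℕ)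
    (hv : v ∈ c.eval (strOracle τ) n) : v ∈ c.eval (strOracle τ') n := by
  refine eval_mono (fun n v hv => ?_) c n v hv
  rw [mem_strOracle] at *
  obtain ⟨b, hb, rfl⟩ := hv
  obtain ⟨u, rfl⟩ := h
  refine ⟨b, ?_, rfl⟩
  obtain ⟨hlt, _⟩ := List.getElem?_eq_some_iff.1 hb
  rw [List.getElem?_append_left hlt, hb]

theorem pre_getElem? (X : ℕ → Bool) (s i : ℕ) (h : i < s) : (pre X s)[i]? = some (X i) := by
  simp [pre, h]

theorem eval_pre_chi {X : ℕ → Bool} (c : OracleCode) {k n v : ℕ}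
    (hv : v ∈ c.eval (strOracle (pre X k)) n) : v ∈ c.eval (chi X) n := by
  refine eval_mono (fun n v hv => ?_) c n v hv
  rw [mem_strOracle] at hv
  obtain ⟨b, hb, rfl⟩ := hv
  obtain ⟨hlt, _⟩ := List.getElem?_eq_some_iff.1 hb
  rw [pre_getElem? X _ _ (by simpa using hlt)] at hb
  simp [chi] at *
  rw [hb]

theorem eval_chi_pre {X : ℕ → Bool} (c : OracleCode) {n v : ℕ}
    (hv : v ∈ c.eval (chi X) n) : ∃ k, ∀ j, k ≤ j → v ∈ c.eval (strOracle (pre X j)) n := by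
  refine eval_compact (fun k => strOracle (pre X k)) (chi X) ?_ ?_ c n v hv
  · intro i j hij n v hv
    rw [mem_strOracle] at *
    obtain ⟨b, hb, rfl⟩ := hv
    refine ⟨b, ?_, rfl⟩
    obtain ⟨hlt, _⟩ := List.getElem?_eq_some_iff.1 hb
    simp at hlt
    rw [pre_getElem? X _ _ hlt] at hb
    rw [pre_getElem? X _ _ (by omega), hb]
  · intro n v hv
    refine ⟨n+1, mem_strOracle.2 ⟨X n, pre_getElem? X _ _ (by omega), ?_⟩⟩
    simpa [chi] using hv

/-! ### Primitive recursive helpers -/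

section prim
variable {α β : Type} [Primcodable α] [Primcodable β]

theorem prim_filter {f : α → List β} {p : α → β → Prop} [∀ a, DecidablePred (p a)]
    (hf : Primrec f) (hp : PrimrecRel p) : Primrec fun a => (f a).filter fun b => p a b := by
  classical
  have h1 : PrimrecRel fun (b : β) (a : α) => p a b := hp.comp Primrec.snd Primrec.fst
  refine (h1.listFilter.comp hf Primrec.id).of_eq fun a => ?_
  exact List.filter_congr fun b _ => by simp

theorem prim_find {f : α → List β} {p : α → β → Prop} [∀ a, DecidablePred (p a)]
    (hf : Primrec f) (hp : PrimrecRel p) : Primrec fun a => (f a).find? fun b => p a b :=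
  (Primrec.list_head?.comp (prim_filter hf hp)).of_eq fun a => by rw [List.head?_filter]

theorem prim_forall {f : α → List β} {p : α → β → Prop}
    (hf : Primrec f) (hp : PrimrecRel p) : PrimrecPred fun a => ∀ b ∈ f a, p a b := by
  have h1 : PrimrecRel fun (b : β) (a : α) => p a b := hp.comp Primrec.snd Primrec.fst
  exact h1.forall_mem_list.comp hf Primrec.id

theorem prim_exists {f : α → List β} {p : α → β → Prop}
    (hf : Primrec f) (hp : PrimrecRel p) : PrimrecPred fun a => ∃ b ∈ f a, p a b := by
  have h1 : PrimrecRel fun (b : β) (a : α) => p a b := hp.comp Primrec.snd Primrec.fst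
  exact h1.exists_mem_list.comp hf Primrec.id

theorem prim_forall_lt {f : α → ℕ} {p : α → ℕ → Prop}
    (hf : Primrec f) (hp : PrimrecRel p) : PrimrecPred fun a => ∀ b < f a, p a b :=
  (prim_forall (Primrec.list_range.comp hf) hp).of_eq fun a => by simp

theorem prim_exists_lt {f : α → ℕ} {p : α → ℕ → Prop}
    (hf : Primrec f) (hp : PrimrecRel p) : PrimrecPred fun a => ∃ b < f a, p a b :=
  (prim_exists (Primrec.list_range.comp hf) hp).of_eq fun a => by simp

theorem prim_pfx {f g : α → List β} [DecidableEq β] (hf : Primrec f) (hg : Primrec g) :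
    PrimrecPred fun a => f a <+: g a :=
  (Primrec.eq.comp hf (Primrec.list_take.comp (Primrec.list_length.comp hf) hg)).of_eq
    fun _ => List.prefix_iff_eq_take.symm

end prim

/-! ### Recursively enumerable predicates -/

theorem re_of_search {α : Type} [Primcodable α] {q : α → ℕ → Bool} (hq : Computable₂ q) :
    REPred fun a => ∃ s, q a s = true := by
  have h : Partrec fun a => Nat.rfind fun s => (Part.some (q a s) : Part Bool) :=
    Partrec.rfind hq.partrec₂
  refine h.dom_re.of_eq fun a => ?_
  refine Nat.rfind_dom.trans ?_
  constructor
  · rintro ⟨n, h1, _⟩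
    exact ⟨n, (Part.mem_some_iff.1 h1).symm⟩
  · rintro ⟨n, h1⟩
    exact ⟨n, Part.mem_some_iff.2 h1.symm, fun _ => trivial⟩

theorem re_search {α : Type} [Primcodable α] {p : α → Prop} (hp : REPred p) :
    ∃ q : α → ℕ → Bool, Primrec₂ q ∧ (∀ a s t, s ≤ t → q a s = true → q a t = true) ∧
      ∀ a, p a ↔ ∃ s, q a s = true := by
  have h1 : Partrec fun a => Part.assert (p a) fun _ => Part.some () := hp
  have h2 : Nat.Partrec fun n => Part.bind (Encodable.decode (α := α) n) fun a =>
      (Part.assert (p a) fun _ => Part.some ()).map Encodable.encode := h1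
  obtain ⟨c, hc⟩ := Nat.Partrec.Code.exists_code.1 h2
  refine ⟨fun a s => (Nat.Partrec.Code.evaln s c (Encodable.encode a)).isSome, ?_, ?_, ?_⟩
  · refine Primrec.option_isSome.comp ?_
    exact Nat.Partrec.Code.primrec_evaln.comp (Primrec.pair (Primrec.pair Primrec.snd
      (Primrec.const c)) (Primrec.encode.comp Primrec.fst))
  · intro a s t hst h
    obtain ⟨v, hv⟩ := Option.isSome_iff_exists.1 h
    exact Option.isSome_iff_exists.2 ⟨v, Nat.Partrec.Code.evaln_mono hst hv⟩
  · intro a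
    have h3 : (c.eval (Encodable.encode a)).Dom ↔ p a := by
      rw [hc]; simp [Part.assert]
    rw [← h3]
    constructor
    · intro h
      obtain ⟨k, hk⟩ := Nat.Partrec.Code.evaln_complete.1 (Part.get_mem h)
      exact ⟨k, Option.isSome_iff_exists.2 ⟨_, hk⟩⟩
    · rintro ⟨s, hs⟩
      obtain ⟨v, hv⟩ := Option.isSome_iff_exists.1 hs
      exact Part.dom_iff_mem.2 ⟨v, Nat.Partrec.Code.evaln_sound hv⟩

theorem re_mem {α : Type} [Primcodable α] {f : α →. ℕ} (hf : Partrec f) :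
    REPred fun x : α × ℕ => x.2 ∈ f x.1 := by
  have h : Partrec fun x : α × ℕ => (f x.1).bind fun w =>
      (((if w = x.2 then some () else none : Option Unit)) : Part Unit) := by
    refine Partrec.bind (hf.comp Computable.fst) ?_
    refine Computable.ofOption ?_
    refine Primrec.to_comp ?_
    exact Primrec.ite (Primrec.eq.comp Primrec.snd (Primrec.snd.comp Primrec.fst))
      (Primrec.const _) (Primrec.const _)
  refine h.dom_re.of_eq fun x => ?_
  constructor
  · rintro ⟨h1, h2⟩
    by_cases h3 : (f x.1).get h1 = x.2
    · rw [← h3]; exact Part.get_mem h1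
    · simp [h3] at h2
  · intro h
    obtain ⟨h1, h2⟩ := h
    exact ⟨h1, by simp [h2]⟩

theorem re_comp {α β : Type} [Primcodable α] [Primcodable β] {p : β → Prop} (hp : REPred p)
    {f : α → β} (hf : Computable f) : REPred fun a => p (f a) := by
  have h1 : Partrec fun a => Part.assert (p a) fun _ => Part.some () := hp
  exact h1.comp hf

/-- enumeration of strings by stage `s`. -/
def enumBy (e s : ℕ) (σ : List Bool) : Bool :=
  (Nat.Partrec.Code.evaln s (Denumerable.ofNat Nat.Partrec.Code e) (Encodable.encode σ)).isSome

theorem enumBy_primrec : Primrec fun x : (ℕ × ℕ) × List Bool => enumBy x.1.1 x.1.2 x.2 := by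
  refine Primrec.option_isSome.comp ?_
  exact Nat.Partrec.Code.primrec_evaln.comp (Primrec.pair (Primrec.pair
    (Primrec.snd.comp Primrec.fst)
    ((Primrec.ofNat Nat.Partrec.Code).comp (Primrec.fst.comp Primrec.fst)))
    (Primrec.encode.comp Primrec.snd))

theorem enumBy_mono {e s t : ℕ} {σ : List Bool} (hst : s ≤ t) (h : enumBy e s σ = true) :
    enumBy e t σ = true := by
  obtain ⟨v, hv⟩ := Option.isSome_iff_exists.1 h
  exact Option.isSome_iff_exists.2 ⟨v, Nat.Partrec.Code.evaln_mono hst hv⟩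

/-- The c.e. set with index `e`. -/
def W (e : ℕ) : Set (List Bool) := {σ | ∃ s, enumBy e s σ = true}

theorem exists_index {p : List Bool → Prop} (hp : REPred p) :
    ∃ e, ∀ σ, σ ∈ W e ↔ p σ := by
  have h2 : Nat.Partrec fun n => Part.bind (Encodable.decode (α := List Bool) n) fun a =>
      (Part.assert (p a) fun _ => Part.some ()).map Encodable.encode := hp
  obtain ⟨c, hc⟩ := Nat.Partrec.Code.exists_code.1 h2
  refine ⟨Encodable.encode c, fun a => ?_⟩
  have h3 : (c.eval (Encodable.encode a)).Dom ↔ p a := by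
    rw [hc]; simp [Part.assert]
  rw [← h3]
  simp only [W, Set.mem_ofPred_eq, enumBy, Denumerable.ofNat_encode]
  constructor
  · rintro ⟨s, hs⟩
    obtain ⟨v, hv⟩ := Option.isSome_iff_exists.1 hs
    exact Part.dom_iff_mem.2 ⟨v, Nat.Partrec.Code.evaln_sound hv⟩
  · intro h
    obtain ⟨k, hk⟩ := Nat.Partrec.Code.evaln_complete.1 (Part.get_mem h)
    exact ⟨k, Option.isSome_iff_exists.2 ⟨_, hk⟩⟩

theorem W_re (e : ℕ) : REPred fun σ => σ ∈ W e :=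
  re_of_search (q := fun σ s => enumBy e s σ) (Primrec.to_comp (enumBy_primrec.comp
    (Primrec.pair (Primrec.pair (Primrec.const e) Primrec.snd) Primrec.fst)))

/-! ### Prefix lemmas -/

theorem pre_pfx (X : ℕ → Bool) {s t : ℕ} (h : s ≤ t) : pre X s <+: pre X t := by
  obtain ⟨k, rfl⟩ := Nat.exists_eq_add_of_le h
  induction k with
  | zero => simp
  | succ k ih =>
    rw [← Nat.add_assoc, pre_succ]
    exact (ih (by omega)).trans (List.prefix_append _ _)

theorem pre_take (X : ℕ → Bool) {s t : ℕ} (h : s ≤ t) : (pre X t).take s = pre X s := by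
  have := List.prefix_iff_eq_take.1 (pre_pfx X h)
  simpa using this.symm

theorem prefix_pre_iff (X : ℕ → Bool) (σ : List Bool) (t : ℕ) :
    σ <+: pre X t ↔ σ = pre X σ.length ∧ σ.length ≤ t := by
  constructor
  · intro h
    have h1 : σ.length ≤ t := by simpa using h.length_le
    refine ⟨?_, h1⟩
    rw [← pre_take X h1]
    exact List.prefix_iff_eq_take.1 h
  · rintro ⟨h1, h2⟩
    rw [h1]
    exact pre_pfx X h2

theorem extendsStr_iff (X : ℕ → Bool) (σ : List Bool) : extendsStr X σ ↔ σ = pre X σ.length := by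
  constructor
  · intro h
    apply List.ext_getElem
    · simp
    · intro i h1 h2
      have := h ⟨i, h1⟩
      simpa [pre] using this.symm
  · intro h i
    have := congrArg (fun l => l[i.1]?) h
    simp only [pre_getElem? X σ.length i.1 i.2] at this
    simp at this
    exact this.symm

theorem prefix_total {a b c : List Bool} (h1 : a <+: c) (h2 : b <+: c) : a <+: b ∨ b <+: a :=
  List.prefix_or_prefix_of_prefix h1 h2

open MeasureTheory

/-! ### Measure -/

/-- The fair coin. -/
noncomputable def coin : Measure Bool := (PMF.uniformOfFintype Bool).toMeasure

instance coin_prob : IsProbabilityMeasure coin := by unfold coin; infer_instance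

/-- Lebesgue measure on Cantor space. -/
noncomputable def mu : Measure (ℕ → Bool) := Measure.infinitePi fun _ => coin

instance mu_prob : IsProbabilityMeasure mu := by unfold mu; infer_instance

theorem coin_singleton (b : Bool) : coin {b} = 2⁻¹ := by
  unfold coin
  rw [PMF.toMeasure_apply_singleton _ _ (measurableSet_singleton b)]
  simp

/-- The cylinder of a string. -/
def cyl (ρ : List Bool) : Set (ℕ → Bool) := {X | ρ = pre X ρ.length}

theorem mem_cyl {ρ : List Bool} {X : ℕ → Bool} : X ∈ cyl ρ ↔ ρ = pre X ρ.length := Iff.rfl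

theorem cyl_eq_pi (ρ : List Bool) :
    cyl ρ = Set.pi (Finset.range ρ.length : Set ℕ) fun i => {(ρ[i]?).getD false} := by
  ext X
  rw [mem_cyl, ← extendsStr_iff]
  simp only [extendsStr, Set.mem_pi, Finset.coe_range, Set.mem_Iio, Set.mem_singleton_iff]
  constructor
  · intro h i hi
    have := h ⟨i, hi⟩
    simpa [List.getElem?_eq_getElem hi] using this
  · intro h i
    have := h i.1 i.2
    simpa [List.getElem?_eq_getElem i.2] using this

theorem measurable_cyl (ρ : List Bool) : MeasurableSet (cyl ρ) := by
  rw [cyl_eq_pi]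
  exact MeasurableSet.pi (Finset.countable_toSet _) fun i _ => measurableSet_singleton _

theorem mu_cyl (ρ : List Bool) : mu (cyl ρ) = (2⁻¹ : ℝ≥0∞) ^ ρ.length := by
  rw [cyl_eq_pi]
  unfold mu
  rw [Measure.infinitePi_pi _ (fun i _ => measurableSet_singleton _)]
  simp [coin_singleton]

theorem muReal_cyl (ρ : List Bool) : mu.real (cyl ρ) = (1/2 : ℝ) ^ ρ.length := by
  simp [Measure.real, mu_cyl]

theorem pre_eq_ofFn (X : ℕ → Bool) (n : ℕ) : pre X n = List.ofFn fun i : Fin n => X i := by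
  apply List.ext_getElem
  · simp
  · intro i h1 h2; simp [pre]

theorem mu_openOf_le (V : Set (List Bool)) : mu (openOf V) ≤ stringMeasure V := by
  classical
  have h : openOf V = ⋃ n, {X | ∃ σ ∈ V, σ <+: pre X n} := by
    ext X
    simp only [openOf, Set.mem_ofPred_eq, Set.mem_iUnion]
    constructor
    · rintro ⟨σ, h1, h2⟩
      refine ⟨σ.length, σ, h1, ?_⟩
      rw [← (extendsStr_iff X σ).1 h2]
    · rintro ⟨n, σ, h1, h2⟩
      exact ⟨σ, h1, (extendsStr_iff X σ).2 ((prefix_pre_iff X σ n).1 h2).1⟩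
  have hm : Monotone fun n => {X : ℕ → Bool | ∃ σ ∈ V, σ <+: pre X n} := by
    intro m n hmn X
    rintro ⟨σ, h1, h2⟩
    exact ⟨σ, h1, h2.trans (pre_pfx X hmn)⟩
  rw [h, hm.measure_iUnion]
  unfold stringMeasure
  refine iSup_mono fun n => ?_
  let T : Finset (Fin n → Bool) := Finset.univ.filter fun f => ∃ σ ∈ V, σ <+: List.ofFn f
  have h2 : {X : ℕ → Bool | ∃ σ ∈ V, σ <+: pre X n} ⊆ ⋃ f ∈ T, cyl (List.ofFn f) := by
    intro X hX
    simp only [Set.mem_iUnion]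
    refine ⟨fun i => X i, ?_, ?_⟩
    · simpa [T, ← pre_eq_ofFn] using hX
    · rw [mem_cyl, ← pre_eq_ofFn]; simp
  refine (measure_mono h2).trans ((measure_biUnion_finset_le _ _).trans ?_)
  simp only [mu_cyl, List.length_ofFn, Finset.sum_const, nsmul_eq_mul]
  rw [Nat.card_eq_fintype_card, Fintype.card_subtype, ENNReal.div_eq_inv_mul, mul_comm,
    ENNReal.inv_pow]

theorem mu_null {S : Set (ℕ → Bool)} (h : cantorMeasure S = 0) : mu S = 0 := by
  refine le_antisymm ?_ zero_le
  rw [← h]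
  unfold cantorMeasure
  exact le_iInf₂ fun V hV => (measure_mono hV).trans (mu_openOf_le V)

/-- All strings of length `n`. -/
def strs : ℕ → List (List Bool)
  | 0 => [[]]
  | n+1 => (strs n).flatMap fun σ => [σ ++ [false], σ ++ [true]]

theorem mem_strs {n : ℕ} {σ : List Bool} : σ ∈ strs n ↔ σ.length = n := by
  induction n generalizing σ with
  | zero => simp [strs]
  | succ n ih =>
    simp only [strs, List.mem_flatMap, ih]
    constructor
    · rintro ⟨τ, h1, h2⟩
      simp at h2
      rcases h2 with rfl | rfl <;> simp [h1]
    · intro h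
      rcases List.eq_nil_or_concat σ with rfl | ⟨τ, b, rfl⟩
      · simp at h
      · refine ⟨τ, by simpa using h, ?_⟩
        cases b <;> simp

theorem strs_nodup (n : ℕ) : (strs n).Nodup := by
  induction n with
  | zero => simp [strs]
  | succ n ih =>
    simp only [strs]
    rw [List.nodup_flatMap]
    refine ⟨fun σ _ => by simp, ?_⟩
    refine ih.imp ?_
    intro a b hab
    simp [Function.onFun]
    exact fun h => hab h.symm

theorem strs_card (n : ℕ) : (strs n).length = 2 ^ n := by
  induction n with
  | zero => simp [strs]
  | succ n ih => simp [strs, ih, pow_succ]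

theorem pre_set_eq (P : List Bool → Prop) [DecidablePred P] (n : ℕ) :
    {X : ℕ → Bool | P (pre X n)} = ⋃ σ ∈ ((strs n).filter P).toFinset, cyl σ := by
  ext X
  simp only [Set.mem_ofPred_eq, Set.mem_iUnion, List.mem_toFinset, List.mem_filter, mem_strs,
    decide_eq_true_eq, exists_prop]
  constructor
  · intro h
    exact ⟨pre X n, ⟨by simp, h⟩, by rw [mem_cyl]; simp⟩
  · rintro ⟨σ, ⟨h1, h2⟩, h3⟩
    rw [mem_cyl, h1] at h3
    rwa [← h3]

theorem measurable_pre_set (P : List Bool → Prop) (n : ℕ) :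
    MeasurableSet {X : ℕ → Bool | P (pre X n)} := by
  classical
  rw [pre_set_eq]
  exact Finset.measurableSet_biUnion _ fun σ _ => measurable_cyl σ

theorem mu_pre_set (P : List Bool → Prop) [DecidablePred P] (n : ℕ) :
    mu.real {X : ℕ → Bool | P (pre X n)} = ((strs n).filter P).length / 2 ^ n := by
  rw [pre_set_eq, measureReal_biUnion_finset]
  · have : ∀ σ ∈ ((strs n).filter P).toFinset, mu.real (cyl σ) = (1/2 : ℝ) ^ n := by
      intro σ hσ
      simp only [List.mem_toFinset, List.mem_filter, mem_strs] at hσ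
      rw [muReal_cyl, hσ.1]
    rw [Finset.sum_congr rfl this, Finset.sum_const,
      List.toFinset_card_of_nodup ((strs_nodup n).filter _)]
    simp [div_eq_mul_inv]
  · intro σ hσ τ hτ hne
    simp only [List.coe_toFinset, Set.mem_ofPred_eq, List.mem_filter, mem_strs] at hσ hτ
    refine Set.disjoint_left.2 fun X h1 h2 => hne ?_
    rw [mem_cyl] at h1 h2
    rw [h1, h2, hσ.1, hτ.1]
  · intro σ _; exact measurable_cyl σ

/-- No prefix of `σ` is enumerated by stage `s`. -/
def surv (e s : ℕ) (σ : List Bool) : Prop := ∀ k < σ.length + 1, enumBy e s (σ.take k) = false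

instance (e s : ℕ) : DecidablePred (surv e s) := fun σ => by unfold surv; infer_instance

/-- Number of surviving strings of length `s` above `ρ`. -/
def cnt (e s : ℕ) (ρ : List Bool) : ℕ :=
  ((strs s).filter fun σ => ρ <+: σ ∧ surv e s σ).length

/-- Stage-`s` goodness. -/
def good (e s : ℕ) (ρ : List Bool) (a : ℕ) : Prop := 2 ^ s ≤ cnt e s ρ * 2 ^ a

instance (e s : ℕ) (ρ : List Bool) (a : ℕ) : Decidable (good e s ρ a) := by
  unfold good; infer_instance

/-- The class with index `e`. -/
def N (e : ℕ) : Set (ℕ → Bool) := {X | ∀ n, pre X n ∉ W e}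

/-- Stage approximation. -/
def Nst (e s : ℕ) : Set (ℕ → Bool) := {X | surv e s (pre X s)}

theorem Nst_anti (e : ℕ) : Antitone (Nst e) := by
  intro s t hst X hX k hk
  simp only [pre_length] at hk
  have := hX k (by simp; omega)
  rw [pre_take X (by omega)] at this ⊢
  by_contra h
  have h' : enumBy e s (pre X k) = true := by simpa using h
  rw [enumBy_mono hst h'] at this
  simp at this

theorem N_eq (e : ℕ) : N e = ⋂ s, Nst e s := by
  ext X
  simp only [N, Set.mem_ofPred_eq, Set.mem_iInter]
  constructor
  · intro h s k hk
    simp only [pre_length] at hk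
    rw [pre_take X (by omega)]
    by_contra h'
    exact h k ⟨s, by simpa using h'⟩
  · rintro h n ⟨s, hs⟩
    have := h (max s n) n (by simp)
    rw [pre_take X (le_max_right s n), enumBy_mono (le_max_left s n) hs] at this
    simp at this

theorem measurable_Nst (e s : ℕ) : MeasurableSet (Nst e s) := measurable_pre_set (surv e s) s

theorem measurable_N (e : ℕ) : MeasurableSet (N e) := by
  rw [N_eq]; exact MeasurableSet.iInter fun s => measurable_Nst e s

/-- True goodness. -/
def Good (e : ℕ) (ρ : List Bool) (a : ℕ) : Prop := (1/2 : ℝ) ^ a ≤ mu.real (N e ∩ cyl ρ)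

theorem good_iff {e s a : ℕ} {ρ : List Bool} (h : ρ.length ≤ s) :
    good e s ρ a ↔ (1/2 : ℝ) ^ a ≤ mu.real (Nst e s ∩ cyl ρ) := by
  have h1 : Nst e s ∩ cyl ρ = {X | ρ <+: pre X s ∧ surv e s (pre X s)} := by
    ext X
    simp only [Set.mem_inter_iff, Set.mem_ofPred_eq, prefix_pre_iff, h, and_true, mem_cyl, Nst]
    tauto
  rw [h1, mu_pre_set (fun σ => ρ <+: σ ∧ surv e s σ) s]
  have h2 : ((List.filter (fun σ => decide (ρ <+: σ ∧ surv e s σ)) (strs s)).length : ℝ)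
    = cnt e s ρ := rfl
  rw [h2, le_div_iff₀ (by positivity), one_div, inv_pow, inv_mul_le_iff₀ (by positivity)]
  unfold good
  rw [mul_comm]
  exact_mod_cast Iff.rfl

theorem not_good_short {e s a : ℕ} {ρ : List Bool} (h : s < ρ.length) : ¬ good e s ρ a := by
  unfold good cnt
  rw [List.filter_eq_nil_iff.2]
  · simp
  · intro σ hσ
    rw [mem_strs] at hσ
    simp only [decide_eq_true_eq, not_and]
    intro h1
    have := h1.length_le
    omega

theorem Good.good {e s a : ℕ} {ρ : List Bool} (hG : Good e ρ a) (h : ρ.length ≤ s) :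
    good e s ρ a := by
  rw [good_iff h]
  refine le_trans hG (measureReal_mono (Set.inter_subset_inter_left _ ?_))
  rw [N_eq]
  exact Set.iInter_subset _ s

theorem eventually_not_good {e a : ℕ} {ρ : List Bool} (hG : ¬ Good e ρ a) :
    ∃ s0, ∀ s, s0 ≤ s → ¬ good e s ρ a := by
  have h1 : Filter.Tendsto (fun s => mu (Nst e s ∩ cyl ρ)) Filter.atTop
      (nhds (mu (⋂ s, (Nst e s ∩ cyl ρ)))) := by
    refine tendsto_measure_iInter_atTop
      (fun s => ((measurable_Nst e s).inter (measurable_cyl ρ)).nullMeasurableSet) ?_ ?_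
    · intro s t hst
      exact Set.inter_subset_inter_left _ (Nst_anti e hst)
    · exact ⟨0, measure_ne_top _ _⟩
  rw [← Set.iInter_inter, ← N_eq] at h1
  have h2 : Filter.Tendsto (fun s => mu.real (Nst e s ∩ cyl ρ)) Filter.atTop
      (nhds (mu.real (N e ∩ cyl ρ))) :=
    (ENNReal.tendsto_toReal (measure_ne_top _ _)).comp h1
  have h3 := h2.eventually (gt_mem_nhds (not_le.1 hG))
  obtain ⟨s0, hs0⟩ := Filter.eventually_atTop.1 h3
  refine ⟨max s0 ρ.length, fun s hs => ?_⟩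
  rw [good_iff (by omega), not_le]
  exact hs0 s (by omega)

theorem eventually_good_iff (e a : ℕ) (ρ : List Bool) :
    ∃ s0, ∀ s, s0 ≤ s → (good e s ρ a ↔ Good e ρ a) := by
  by_cases h : Good e ρ a
  · exact ⟨ρ.length, fun s hs => ⟨fun _ => h, fun _ => h.good hs⟩⟩
  · obtain ⟨s0, hs0⟩ := eventually_not_good h
    exact ⟨s0, fun s hs => ⟨fun h' => absurd h' (hs0 s hs), fun h' => absurd h' h⟩⟩

theorem Good.prefix_free {e a : ℕ} {ρ : List Bool} (h : Good e ρ a) : ∃ X, X ∈ N e ∩ cyl ρ := by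
  by_contra h'
  have : N e ∩ cyl ρ = ∅ := Set.eq_empty_iff_forall_notMem.2 fun X hX => h' ⟨X, hX⟩
  unfold Good at h
  rw [this, measureReal_empty] at h
  have : (0:ℝ) < (1/2)^a := by positivity
  linarith

theorem cover_bound {e l b : ℕ} {κ : List Bool} (C : List (List Bool)) (hl : κ.length ≤ l)
    (h : ∀ ρ ∈ strs l, κ <+: ρ → Good e ρ b → ∃ c ∈ C, c <+: ρ) :
    mu.real (N e ∩ cyl κ) ≤ (C.map fun c => (1/2 : ℝ) ^ c.length).sum
      + 2 ^ l * (1/2 : ℝ) ^ b := by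
  classical
  let B : Finset (List Bool) := ((strs l).filter fun ρ => ¬ Good e ρ b).toFinset
  have hsub : N e ∩ cyl κ ⊆ (⋃ c ∈ C.toFinset, cyl c) ∪ ⋃ ρ ∈ B, (N e ∩ cyl ρ) := by
    rintro X ⟨hN, hκ⟩
    have hX : X ∈ cyl (pre X l) := by rw [mem_cyl]; simp
    by_cases hg : Good e (pre X l) b
    · left
      obtain ⟨c, hc, hcp⟩ := h (pre X l) (mem_strs.2 (by simp))
        ((prefix_pre_iff X κ l).2 ⟨hκ, hl⟩) hg
      simp only [Set.mem_iUnion]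
      exact ⟨c, by simpa using hc, ((prefix_pre_iff X c l).1 hcp).1⟩
    · right
      simp only [Set.mem_iUnion]
      exact ⟨pre X l, by simp [B, mem_strs, hg], hN, hX⟩
  refine (measureReal_mono hsub).trans ((measureReal_union_le _ _).trans (add_le_add ?_ ?_))
  · refine (measureReal_biUnion_finset_le _ _).trans ?_
    simp only [muReal_cyl]
    clear hsub h
    induction C with
    | nil => simp
    | cons c C ih =>
      rw [List.toFinset_cons, List.map_cons, List.sum_cons]
      by_cases hc : c ∈ C.toFinset
      · rw [Finset.insert_eq_of_mem hc]
        have : (0:ℝ) < (1/2)^c.length := by positivity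
        linarith
      · rw [Finset.sum_insert hc]
        linarith
  · refine (measureReal_biUnion_finset_le _ _).trans ?_
    refine (Finset.sum_le_card_nsmul B _ ((1/2 : ℝ) ^ b) ?_).trans ?_
    · intro ρ hρ
      have : ¬ Good e ρ b := by
        simp [B] at hρ; exact hρ.2
      exact (not_le.1 this).le
    · rw [nsmul_eq_mul]
      refine mul_le_mul_of_nonneg_right ?_ (by positivity)
      have : B.card ≤ 2 ^ l := by
        rw [← strs_card l]
        exact (List.toFinset_card_le _).trans (List.length_filter_le _ _)
      exact_mod_cast this

theorem Good.length_le {e a : ℕ} {κ : List Bool} (h : Good e κ a) : κ.length ≤ a := by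
  have h1 : (1/2 : ℝ) ^ a ≤ (1/2 : ℝ) ^ κ.length := by
    rw [← muReal_cyl]
    exact le_trans h (measureReal_mono Set.inter_subset_right)
  by_contra h2
  have := pow_lt_pow_right_of_lt_one₀ (a := (1/2 : ℝ)) (by norm_num) (by norm_num)
    (not_le.1 h2)
  linarith

theorem Good.two_ext {e a : ℕ} {κ : List Bool} (h : Good e κ a) (ρ0 : List Bool)
    (h0 : ρ0.length = a + 2) :
    ∃ ρ ∈ strs (a+2), κ <+: ρ ∧ Good e ρ (2*a+3) ∧ ρ ≠ ρ0 := by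
  by_contra hcon
  push Not at hcon
  have h1 := cover_bound (e := e) (l := a+2) (b := 2*a+3) (κ := κ) [ρ0]
    (by have := h.length_le; omega) (by
      intro ρ h1 h2 h3
      exact ⟨ρ0, by simp, by rw [hcon ρ h1 h2 h3]⟩)
  have h2 : (1/2 : ℝ) ^ a ≤ _ := h.trans h1
  simp only [List.map_cons, List.map_nil, List.sum_cons, List.sum_nil, h0, add_zero] at h2
  have h3 : (2:ℝ) ^ (a+2) * (1/2) ^ (2*a+3) = (1/2)^a * (1/2) := by
    have : (2:ℝ)^a * (1/2)^a = 1 := by rw [← mul_pow]; norm_num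
    calc (2:ℝ) ^ (a+2) * (1/2) ^ (2*a+3) = (2^a * (1/2)^a) * ((1/2)^a * (1/2)) := by ring
      _ = _ := by rw [this, one_mul]
  rw [h3, pow_add] at h2
  have h4 : (0:ℝ) < (1/2)^a := by positivity
  nlinarith

theorem measurable_openOf (V : Set (List Bool)) : MeasurableSet (openOf V) := by
  have : openOf V = ⋃ σ ∈ V, cyl σ := by
    ext X
    simp [openOf, extendsStr_iff, mem_cyl]
  rw [this]
  exact MeasurableSet.biUnion (Set.to_countable V) fun σ _ => measurable_cyl σ

theorem re_w2r (e i : ℕ) {V : ℕ → Set (List Bool)} (hV : UniformCEIn (fun _ => false) V) :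
    REPred fun σ => σ ∈ W e ∨ ∀ k < i, ∃ m < σ.length + 1, σ.take m ∈ V k := by
  obtain ⟨c, hc⟩ := hV
  have h1 : REPred fun x : ℕ × List Bool => x.2 ∈ V x.1 := by
    have := re_comp (eval_false_partrec c).dom_re
      (f := fun x : ℕ × List Bool => Nat.pair x.1 (Encodable.encode x.2))
      (Primrec.to_comp (Primrec₂.natPair.comp Primrec.fst (Primrec.encode.comp Primrec.snd)))
    exact this.of_eq fun x => (hc x.1 x.2).symm
  obtain ⟨q, hq, hqm, hqi⟩ := re_search h1
  obtain ⟨q2, hq2, hqm2, hqi2⟩ := re_search (W_re e)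
  let P : List Bool → ℕ → Prop := fun σ s => q2 σ s = true ∨
    ∀ k < i, ∃ m < σ.length + 1, q (k, σ.take m) s = true
  have hP : PrimrecRel P := by
    refine PrimrecPred.or ?_ ?_
    · exact Primrec.eq.comp hq2 (Primrec.const true)
    · refine prim_forall_lt (α := List Bool × ℕ) (f := fun _ => i)
        (p := fun x k => ∃ m < x.1.length + 1, q (k, x.1.take m) x.2 = true) (Primrec.const i) ?_
      refine prim_exists_lt (α := (List Bool × ℕ) × ℕ) (f := fun x => x.1.1.length + 1)
        (p := fun x m => q (x.2, x.1.1.take m) x.1.2 = true)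
        (Primrec.succ.comp (Primrec.list_length.comp (Primrec.fst.comp Primrec.fst))) ?_
      refine Primrec.eq.comp (hq.comp (Primrec.pair (Primrec.snd.comp Primrec.fst)
          (Primrec.list_take.comp Primrec.snd ?_)) ?_) (Primrec.const true)
      · exact Primrec.fst.comp (Primrec.fst.comp Primrec.fst)
      · exact Primrec.snd.comp (Primrec.fst.comp Primrec.fst)
  classical
  have h2 := re_of_search (q := fun σ s => decide (P σ s)) hP.decide.to_comp
  refine h2.of_eq fun σ => ?_
  simp only [decide_eq_true_eq, P]
  constructor
  · rintro ⟨s, h | h⟩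
    · exact Or.inl ((hqi2 σ).2 ⟨s, h⟩)
    · right
      intro k hk
      obtain ⟨m, hm, h3⟩ := h k hk
      exact ⟨m, hm, (hqi (k, σ.take m)).2 ⟨s, h3⟩⟩
  · rintro (h | h)
    · obtain ⟨s, hs⟩ := (hqi2 σ).1 h
      exact ⟨s, Or.inl hs⟩
    · have : ∀ k, ∃ s, k < i → ∃ m < σ.length + 1, q (k, σ.take m) s = true := by
        intro k
        by_cases hk : k < i
        · obtain ⟨m, hm, h3⟩ := h k hk
          obtain ⟨s, hs⟩ := (hqi (k, σ.take m)).1 h3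
          exact ⟨s, fun _ => ⟨m, hm, hs⟩⟩
        · exact ⟨0, fun h => absurd h hk⟩
      choose f hf using this
      refine ⟨(Finset.range i).sup f, Or.inr fun k hk => ?_⟩
      obtain ⟨m, hm, h3⟩ := hf k hk
      exact ⟨m, hm, hqm _ _ _ (Finset.le_sup (f := f) (Finset.mem_range.2 hk)) h3⟩

theorem w2r_step {e a : ℕ} {κ : List Bool} (hG : Good e κ a) {V : ℕ → Set (List Bool)}
    (hV : UniformCEIn (fun _ => false) V) (h0 : cantorMeasure (⋂ i, openOf (V i)) = 0) :
    ∃ e', W e ⊆ W e' ∧ (∀ X ∈ N e', X ∉ ⋂ i, openOf (V i)) ∧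
      3/4 * (1/2 : ℝ) ^ a ≤ mu.real (N e' ∩ cyl κ) := by
  let B : ℕ → Set (ℕ → Bool) := fun i => ⋂ k ∈ Set.Iio i, openOf (V k)
  have hBm : ∀ i, MeasurableSet (B i) := fun i =>
    MeasurableSet.biInter (Set.to_countable _) fun k _ => measurable_openOf _
  have hB : ⋂ i, B i = ⋂ i, openOf (V i) := by
    ext X
    simp only [B, Set.mem_iInter, Set.mem_Iio]
    exact ⟨fun h k => h (k+1) k (by omega), fun h i k _ => h k⟩
  have hanti : Antitone B := by
    intro i j hij X hX
    simp only [B, Set.mem_iInter, Set.mem_Iio] at *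
    exact fun k hk => hX k (by omega)
  have h1 : Filter.Tendsto (fun s => mu (B s)) Filter.atTop (nhds (mu (⋂ s, B s))) :=
    tendsto_measure_iInter_atTop (fun s => (hBm s).nullMeasurableSet) hanti
      ⟨0, measure_ne_top _ _⟩
  rw [hB, mu_null h0] at h1
  have h2 : Filter.Tendsto (fun s => mu.real (B s)) Filter.atTop (nhds 0) :=
    (ENNReal.tendsto_toReal (by simp)).comp h1
  have hpos : (0:ℝ) < 1/4 * (1/2)^a := by positivity
  obtain ⟨i, hi⟩ := (h2.eventually (gt_mem_nhds hpos)).exists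
  obtain ⟨e', he'⟩ := exists_index (re_w2r e i hV)
  have key : N e' = N e \ B i := by
    ext X
    simp only [N, Set.mem_ofPred_eq, Set.mem_sdiff, B, Set.mem_iInter, Set.mem_Iio]
    constructor
    · intro h
      refine ⟨fun n hn => h n ((he' _).2 (Or.inl hn)), fun hB => ?_⟩
      have : ∀ k, ∃ n, k < i → pre X n ∈ V k := by
        intro k
        by_cases hk : k < i
        · obtain ⟨σ, h1, h2⟩ := hB k hk
          rw [extendsStr_iff] at h2
          exact ⟨σ.length, fun _ => by rwa [← h2]⟩
        · exact ⟨0, fun h => absurd h hk⟩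
      choose f hf using this
      refine h ((Finset.range i).sup f) ((he' _).2 (Or.inr fun k hk => ⟨f k, ?_, ?_⟩))
      · have := Finset.le_sup (f := f) (Finset.mem_range.2 hk)
        simp; omega
      · rw [pre_take X (Finset.le_sup (f := f) (Finset.mem_range.2 hk))]
        exact hf k hk
    · rintro ⟨h1, h2⟩ n hn
      rcases (he' _).1 hn with h | h
      · exact h1 n h
      · refine h2 fun k hk => ?_
        obtain ⟨m, hm, h3⟩ := h k hk
        simp only [pre_length] at hm
        rw [pre_take X (by omega)] at h3
        exact ⟨_, h3, (extendsStr_iff _ _).2 (by simp)⟩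
  refine ⟨e', fun σ hσ => (he' σ).2 (Or.inl hσ), fun X hX => ?_, ?_⟩
  · rw [key] at hX
    intro h
    apply hX.2
    simp only [B, Set.mem_iInter, Set.mem_Iio] at h ⊢
    exact fun k _ => h k
  · have h3 : N e ∩ cyl κ ⊆ (N e' ∩ cyl κ) ∪ B i := by
      rintro X ⟨h1, h2⟩
      by_cases h : X ∈ B i
      · exact Or.inr h
      · left
        rw [key]
        exact ⟨⟨h1, h⟩, h2⟩
    have h4 := (measureReal_mono h3 (μ := mu)).trans (measureReal_union_le _ _)
    have h5 : (1/2 : ℝ)^a ≤ mu.real (N e ∩ cyl κ) := hG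
    linarith

/-! ### The decoder -/

/-- Claimed coding locations. -/
def claims (gd : ℕ → List Bool → ℕ → Bool) (κ : List Bool) (a : ℕ) : ℕ → List (ℕ × List Bool)
  | 0 => []
  | e+1 => claims gd κ a e ++ (((strs (a+e+3)).find? fun ρ => decide (κ <+: ρ ∧
      gd e ρ (2*a+e+4) = true ∧ ∀ c ∈ claims gd κ a e, ¬ c.2 <+: ρ)).map
        fun ρ => (e, ρ)).toList

/-- Stage-`s` goodness as a Boolean. -/
def gds (s e : ℕ) (ρ : List Bool) (b : ℕ) : Bool := decide (good e s ρ b)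

open Classical in
/-- Limit goodness as a Boolean. -/
noncomputable def gdl (e : ℕ) (ρ : List Bool) (b : ℕ) : Bool := decide (Good e ρ b)

/-- Decoder states. -/
abbrev St : Type := ℕ × ℕ × Option (ℕ × ℕ) × List ℕ

/-- Looking for an index. -/
def step1 (τ : List Bool) (p a : ℕ) (L : List ℕ) : St :=
  match (claims (gds τ.length) (τ.take p) a τ.length).find? (fun c => decide (c.2 <+: τ)) with
  | none => (p, a, none, L)
  | some c => (c.2.length, 2*a+c.1+4, some (c.1, 0), L)

/-- Being the least apparent good extension. -/
def isL (e s a : ℕ) (κ θ : List Bool) : Prop :=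
  θ.length = a + 2 ∧ κ <+: θ ∧ good e s θ (2*a+3) ∧
    ∀ ρ ∈ strs (a+2), (κ <+: ρ ∧ good e s ρ (2*a+3)) →
      Encodable.encode θ ≤ Encodable.encode ρ

/-- Being the greatest apparent good extension. -/
def isR (e s a : ℕ) (κ θ : List Bool) : Prop :=
  θ.length = a + 2 ∧ κ <+: θ ∧ good e s θ (2*a+3) ∧
    ∀ ρ ∈ strs (a+2), (κ <+: ρ ∧ good e s ρ (2*a+3)) →
      Encodable.encode ρ ≤ Encodable.encode θ

instance (e s a : ℕ) (κ θ : List Bool) : Decidable (isL e s a κ θ) := by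
  unfold isL; infer_instance

instance (e s a : ℕ) (κ θ : List Bool) : Decidable (isR e s a κ θ) := by
  unfold isR; infer_instance

/-- Counting. -/
def step2 (τ : List Bool) (p a e n : ℕ) (L : List ℕ) : St :=
  if isL e τ.length a (τ.take p) (τ.take (a+2)) then (a+2, 2*a+3, some (e, n+1), L)
  else if isR e τ.length a (τ.take p) (τ.take (a+2)) then (a+2, 2*a+3, none, L ++ [n])
  else (p, a, some (e, n), L)

/-- One decoding step. -/
def step (τ : List Bool) (st : St) : St :=
  match st.2.2.1 with
  | none => step1 τ st.1 st.2.1 st.2.2.2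
  | some x => step2 τ st.1 st.2.1 x.1 x.2 st.2.2.2

/-- Initial state. -/
def init : St := (0, 0, none, [])

/-- Running the decoder. -/
def run (τ : List Bool) : St := (step τ)^[τ.length] init

section prim
variable {α : Type} [Primcodable α]

theorem strs_prim : Primrec strs := by
  have : Primrec (Nat.rec (motive := fun _ => List (List Bool)) [[]] fun _ l =>
      l.flatMap fun σ => [σ ++ [false], σ ++ [true]]) := by
    refine Primrec.nat_rec₁ _ ?_
    refine Primrec.list_flatMap Primrec.snd ?_
    refine Primrec.list_cons.comp (Primrec.list_append.comp Primrec.snd (Primrec.const _)) ?_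
    exact Primrec.list_cons.comp (Primrec.list_append.comp Primrec.snd (Primrec.const _))
      (Primrec.const [])
  refine this.of_eq fun n => ?_
  induction n with
  | zero => rfl
  | succ n ih => simp only [strs]; rw [← ih]

theorem pow_prim : Primrec fun n : ℕ => 2 ^ n :=
  (Primrec.list_length.comp strs_prim).of_eq strs_card

theorem surv_prim {e s : α → ℕ} {σ : α → List Bool} (he : Primrec e) (hs : Primrec s)
    (hσ : Primrec σ) : PrimrecPred fun a => surv (e a) (s a) (σ a) := by
  refine prim_forall_lt (p := fun a k => enumBy (e a) (s a) ((σ a).take k) = false)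
    (Primrec.succ.comp (Primrec.list_length.comp hσ)) ?_
  refine Primrec.eq.comp (enumBy_primrec.comp (Primrec.pair (Primrec.pair
    (he.comp Primrec.fst) (hs.comp Primrec.fst)) ?_)) (Primrec.const false)
  exact Primrec.list_take.comp Primrec.snd (hσ.comp Primrec.fst)

theorem good_prim {e s b : α → ℕ} {ρ : α → List Bool} (he : Primrec e) (hs : Primrec s)
    (hρ : Primrec ρ) (hb : Primrec b) : PrimrecPred fun a => good (e a) (s a) (ρ a) (b a) := by
  have h1 : Primrec fun a => cnt (e a) (s a) (ρ a) := by
    refine Primrec.list_length.comp (prim_filter (strs_prim.comp hs)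
      (p := fun a σ => ρ a <+: σ ∧ surv (e a) (s a) σ) ?_)
    exact (prim_pfx (hρ.comp Primrec.fst) Primrec.snd).and
      (surv_prim (he.comp Primrec.fst) (hs.comp Primrec.fst) Primrec.snd)
  exact Primrec.nat_le.comp (pow_prim.comp hs) (Primrec.nat_mul.comp h1 (pow_prim.comp hb))

theorem claims_prim {s a e : α → ℕ} {κ : α → List Bool} (hs : Primrec s) (hκ : Primrec κ)
    (ha : Primrec a) (he : Primrec e) : Primrec fun x => claims (gds (s x)) (κ x) (a x) (e x) := by
  have h : Primrec fun x => (e x).rec (motive := fun _ => List (ℕ × List Bool)) []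
    fun n IH => (fun (x : α) (y : ℕ × List (ℕ × List Bool)) => y.2 ++
      (((strs (a x+y.1+3)).find? fun ρ => decide (κ x <+: ρ ∧
      good y.1 (s x) ρ (2*a x+y.1+4) ∧ ∀ c ∈ y.2, ¬ c.2 <+: ρ)).map
        fun ρ => (y.1, ρ)).toList) x (n, IH) := by
    refine Primrec.nat_rec' he (Primrec.const ([] : List (ℕ × List Bool)))
      (h := fun (x : α) (y : ℕ × List (ℕ × List Bool)) => y.2 ++
      (((strs (a x+y.1+3)).find? fun ρ => decide (κ x <+: ρ ∧
      good y.1 (s x) ρ (2*a x+y.1+4) ∧ ∀ c ∈ y.2, ¬ c.2 <+: ρ)).map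
        fun ρ => (y.1, ρ)).toList) ?_
    have hy1 : Primrec fun z : α × (ℕ × List (ℕ × List Bool)) => z.2.1 :=
      Primrec.fst.comp Primrec.snd
    have hy2 : Primrec fun z : α × (ℕ × List (ℕ × List Bool)) => z.2.2 :=
      Primrec.snd.comp Primrec.snd
    have haz : Primrec fun z : α × (ℕ × List (ℕ × List Bool)) => a z.1 := ha.comp Primrec.fst
    refine Primrec.list_append.comp hy2 (Primrec.optionToList.comp (Primrec.option_map ?_ ?_))
    · refine prim_find (α := α × (ℕ × List (ℕ × List Bool)))
        (f := fun z => strs (a z.1 + z.2.1 + 3))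
        (p := fun z ρ => κ z.1 <+: ρ ∧ good z.2.1 (s z.1) ρ (2*a z.1+z.2.1+4) ∧
          ∀ c ∈ z.2.2, ¬ c.2 <+: ρ) ?_ ?_
      · exact strs_prim.comp (Primrec.nat_add.comp (Primrec.nat_add.comp haz hy1)
          (Primrec.const 3))
      · refine (prim_pfx (hκ.comp (Primrec.fst.comp Primrec.fst)) Primrec.snd).and
          (PrimrecPred.and ?_ ?_)
        · refine good_prim (hy1.comp Primrec.fst) (hs.comp (Primrec.fst.comp Primrec.fst))
            Primrec.snd ?_
          exact Primrec.nat_add.comp (Primrec.nat_add.comp (Primrec.nat_mul.comp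
            (Primrec.const 2) (haz.comp Primrec.fst)) (hy1.comp Primrec.fst)) (Primrec.const 4)
        · refine prim_forall (α := (α × (ℕ × List (ℕ × List Bool))) × List Bool)
            (f := fun z => z.1.2.2) (p := fun z c => ¬ c.2 <+: z.2)
            (hy2.comp Primrec.fst) (PrimrecPred.not ?_)
          exact prim_pfx (Primrec.snd.comp Primrec.snd) (Primrec.snd.comp Primrec.fst)
    · exact Primrec.pair (hy1.comp Primrec.fst) Primrec.snd
  refine h.of_eq fun x => ?_
  generalize e x = n
  induction n with
  | zero => rfl
  | succ n ih =>
    simp only [claims, gds, decide_eq_true_eq] at ih ⊢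
    rw [← ih]

theorem isL_prim {e s a : α → ℕ} {κ θ : α → List Bool} (he : Primrec e) (hs : Primrec s)
    (ha : Primrec a) (hκ : Primrec κ) (hθ : Primrec θ) :
    PrimrecPred fun x => isL (e x) (s x) (a x) (κ x) (θ x) := by
  have ha2 : Primrec fun x => a x + 2 := Primrec.nat_add.comp ha (Primrec.const 2)
  have hb : Primrec fun x => 2 * a x + 3 :=
    Primrec.nat_add.comp (Primrec.nat_mul.comp (Primrec.const 2) ha) (Primrec.const 3)
  have hf : Primrec (Prod.fst : α × List Bool → α) := Primrec.fst
  have hs2 : Primrec (Prod.snd : α × List Bool → List Bool) := Primrec.snd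
  refine (Primrec.eq.comp (Primrec.list_length.comp hθ) ha2).and ((prim_pfx hκ hθ).and
    ((good_prim he hs hθ hb).and (prim_forall (strs_prim.comp ha2)
      (p := fun x ρ => (κ x <+: ρ ∧ good (e x) (s x) ρ (2*a x+3)) →
      Encodable.encode (θ x) ≤ Encodable.encode ρ) ?_)))
  have h1 : PrimrecPred fun z : α × List Bool => ¬ (κ z.1 <+: z.2 ∧
      good (e z.1) (s z.1) z.2 (2*a z.1+3)) ∨
      Encodable.encode (θ z.1) ≤ Encodable.encode z.2 :=
    (((prim_pfx (hκ.comp hf) hs2).and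
      (good_prim (he.comp hf) (hs.comp hf) hs2 (hb.comp hf))).not).or
      (Primrec.nat_le.comp (Primrec.encode.comp (hθ.comp hf)) (Primrec.encode.comp hs2))
  exact h1.of_eq fun z => imp_iff_not_or.symm

theorem isR_prim {e s a : α → ℕ} {κ θ : α → List Bool} (he : Primrec e) (hs : Primrec s)
    (ha : Primrec a) (hκ : Primrec κ) (hθ : Primrec θ) :
    PrimrecPred fun x => isR (e x) (s x) (a x) (κ x) (θ x) := by
  have ha2 : Primrec fun x => a x + 2 := Primrec.nat_add.comp ha (Primrec.const 2)
  have hb : Primrec fun x => 2 * a x + 3 :=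
    Primrec.nat_add.comp (Primrec.nat_mul.comp (Primrec.const 2) ha) (Primrec.const 3)
  have hf : Primrec (Prod.fst : α × List Bool → α) := Primrec.fst
  have hs2 : Primrec (Prod.snd : α × List Bool → List Bool) := Primrec.snd
  refine (Primrec.eq.comp (Primrec.list_length.comp hθ) ha2).and ((prim_pfx hκ hθ).and
    ((good_prim he hs hθ hb).and (prim_forall (strs_prim.comp ha2)
      (p := fun x ρ => (κ x <+: ρ ∧ good (e x) (s x) ρ (2*a x+3)) →
      Encodable.encode ρ ≤ Encodable.encode (θ x)) ?_)))
  have h1 : PrimrecPred fun z : α × List Bool => ¬ (κ z.1 <+: z.2 ∧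
      good (e z.1) (s z.1) z.2 (2*a z.1+3)) ∨
      Encodable.encode z.2 ≤ Encodable.encode (θ z.1) :=
    (((prim_pfx (hκ.comp hf) hs2).and
      (good_prim (he.comp hf) (hs.comp hf) hs2 (hb.comp hf))).not).or
      (Primrec.nat_le.comp (Primrec.encode.comp hs2) (Primrec.encode.comp (hθ.comp hf)))
  exact h1.of_eq fun z => imp_iff_not_or.symm

theorem step1_prim {τ : α → List Bool} {p a : α → ℕ} {L : α → List ℕ} (hτ : Primrec τ)
    (hp : Primrec p) (ha : Primrec a) (hL : Primrec L) :
    Primrec fun x => step1 (τ x) (p x) (a x) (L x) := by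
  have h : Primrec fun x => Option.casesOn (motive := fun _ => St)
      ((claims (gds (τ x).length) ((τ x).take (p x)) (a x)
      (τ x).length).find? (fun c => decide (c.2 <+: (τ x)))) ((p x, a x, none, L x) : St)
      (fun c => (c.2.length, 2*a x+c.1+4, some (c.1, 0), L x)) := by
    refine Primrec.option_casesOn ?_ ?_ ?_
    · exact prim_find (claims_prim (Primrec.list_length.comp hτ) (Primrec.list_take.comp hp hτ) ha
        (Primrec.list_length.comp hτ)) (p := fun x c => c.2 <+: τ x)
        (prim_pfx (Primrec.snd.comp Primrec.snd) (hτ.comp Primrec.fst))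
    · exact Primrec.pair hp (Primrec.pair ha (Primrec.pair (Primrec.const _) hL))
    · refine Primrec.pair (Primrec.list_length.comp (Primrec.snd.comp Primrec.snd)) (Primrec.pair
        ?_ (Primrec.pair ?_ (hL.comp Primrec.fst)))
      · exact Primrec.nat_add.comp (Primrec.nat_add.comp (Primrec.nat_mul.comp
            (Primrec.const 2) (ha.comp Primrec.fst)) (Primrec.fst.comp Primrec.snd))
            (Primrec.const 4)
      · exact Primrec.option_some.comp (Primrec.pair (Primrec.fst.comp Primrec.snd)
          (Primrec.const 0))
  refine h.of_eq fun x => ?_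
  unfold step1
  split <;> rename_i hh <;> rw [hh]

theorem step2_prim {τ : α → List Bool} {p a e n : α → ℕ} {L : α → List ℕ} (hτ : Primrec τ)
    (hp : Primrec p) (ha : Primrec a) (he : Primrec e) (hn : Primrec n) (hL : Primrec L) :
    Primrec fun x => step2 (τ x) (p x) (a x) (e x) (n x) (L x) := by
  have ha2 : Primrec fun x => a x + 2 := Primrec.nat_add.comp ha (Primrec.const 2)
  have hb : Primrec fun x => 2 * a x + 3 :=
    Primrec.nat_add.comp (Primrec.nat_mul.comp (Primrec.const 2) ha) (Primrec.const 3)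
  unfold step2
  refine Primrec.ite (isL_prim he (Primrec.list_length.comp hτ) ha (Primrec.list_take.comp hp hτ)
    (Primrec.list_take.comp ha2 hτ)) ?_ (Primrec.ite (isR_prim he (Primrec.list_length.comp hτ) ha
    (Primrec.list_take.comp hp hτ) (Primrec.list_take.comp ha2 hτ)) ?_ ?_)
  · exact Primrec.pair ha2 (Primrec.pair hb (Primrec.pair (Primrec.option_some.comp
      (Primrec.pair he (Primrec.succ.comp hn))) hL))
  · exact Primrec.pair ha2 (Primrec.pair hb (Primrec.pair (Primrec.const _)
      (Primrec.list_append.comp hL (Primrec.list_cons.comp hn (Primrec.const [])))))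
  · exact Primrec.pair hp (Primrec.pair ha (Primrec.pair (Primrec.option_some.comp
      (Primrec.pair he hn)) hL))

theorem step_prim : Primrec₂ step := by
  have hst : Primrec fun z : List Bool × St => z.2 := Primrec.snd
  have h3 : Primrec fun z : List Bool × St => z.2.2.2.2 :=
    Primrec.snd.comp (Primrec.snd.comp (Primrec.snd.comp hst))
  have h2 : Primrec fun z : List Bool × St => z.2.2.2.1 :=
    Primrec.fst.comp (Primrec.snd.comp (Primrec.snd.comp hst))
  have h1 : Primrec fun z : List Bool × St => z.2.2.1 :=
    Primrec.fst.comp (Primrec.snd.comp hst)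
  have h0 : Primrec fun z : List Bool × St => z.2.1 := Primrec.fst.comp hst
  have h : Primrec fun z : List Bool × St => Option.casesOn (motive := fun _ => St) z.2.2.2.1
      (step1 z.1 z.2.1 z.2.2.1 z.2.2.2.2)
      (fun x => step2 z.1 z.2.1 z.2.2.1 x.1 x.2 z.2.2.2.2) := by
    refine Primrec.option_casesOn h2 (step1_prim Primrec.fst h0 h1 h3) ?_
    exact step2_prim (Primrec.fst.comp Primrec.fst) (h0.comp Primrec.fst) (h1.comp Primrec.fst)
      (Primrec.fst.comp Primrec.snd) (Primrec.snd.comp Primrec.snd) (h3.comp Primrec.fst)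
  refine h.of_eq fun z => ?_
  unfold step
  split <;> rename_i hh <;> rw [hh]

theorem run_prim : Primrec run :=
  Primrec.nat_iterate Primrec.list_length (Primrec.const init) step_prim

end prim

/-! ### Analysis of the decoder -/

theorem claims_prefix (gd : ℕ → List Bool → ℕ → Bool) (κ : List Bool) (a : ℕ) {e e' : ℕ}
    (h : e ≤ e') : claims gd κ a e <+: claims gd κ a e' := by
  induction e', h using Nat.le_induction with
  | base => exact List.prefix_refl _
  | succ n _ ih => exact ih.trans (List.prefix_append _ _)

theorem claims_congr {gd gd' : ℕ → List Bool → ℕ → Bool} (κ : List Bool) (a E : ℕ)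
    (h : ∀ e < E, ∀ ρ ∈ strs (a+e+3), gd e ρ (2*a+e+4) = gd' e ρ (2*a+e+4)) :
    claims gd κ a E = claims gd' κ a E := by
  induction E with
  | zero => rfl
  | succ n ih =>
    simp only [claims]
    rw [← ih fun e he => h e (by omega)]
    congr 3
    have : ∀ l : List (List Bool), (∀ ρ ∈ l, gd n ρ (2*a+n+4) = gd' n ρ (2*a+n+4)) →
      l.find? (fun ρ => decide (κ <+: ρ ∧ gd n ρ (2*a+n+4) = true ∧
        ∀ c ∈ claims gd κ a n, ¬ c.2 <+: ρ)) =
      l.find? (fun ρ => decide (κ <+: ρ ∧ gd' n ρ (2*a+n+4) = true ∧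
        ∀ c ∈ claims gd κ a n, ¬ c.2 <+: ρ)) := by
      intro l
      induction l with
      | nil => intro _; rfl
      | cons x l ih =>
        intro hl
        rw [List.find?_cons, List.find?_cons, hl x (by simp), ih fun ρ hρ => hl ρ (by simp [hρ])]
    exact this _ (h n (by omega))

theorem good_settle (e b : ℕ) (l : List (List Bool)) :
    ∃ t, ∀ s ≥ t, ∀ ρ ∈ l, (good e s ρ b ↔ Good e ρ b) := by
  induction l with
  | nil => exact ⟨0, by simp⟩
  | cons x l ih =>
    obtain ⟨t, ht⟩ := ih
    obtain ⟨t', ht'⟩ := eventually_good_iff e b x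
    refine ⟨max t t', fun s hs ρ hρ => ?_⟩
    rcases List.mem_cons.1 hρ with rfl | h
    · exact ht' s (le_trans (le_max_right _ _) hs)
    · exact ht s (le_trans (le_max_left _ _) hs) ρ h

theorem claims_settle (κ : List Bool) (a E : ℕ) :
    ∃ t, ∀ s ≥ t, claims (gds s) κ a E = claims gdl κ a E := by
  have : ∃ t, ∀ s ≥ t, ∀ e < E, ∀ ρ ∈ strs (a+e+3), gds s e ρ (2*a+e+4) = gdl e ρ (2*a+e+4) := by
    induction E with
    | zero => exact ⟨0, by simp⟩
    | succ n ih =>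
      obtain ⟨t, ht⟩ := ih
      obtain ⟨t', ht'⟩ := good_settle n (2*a+n+4) (strs (a+n+3))
      refine ⟨max t t', fun s hs e he ρ hρ => ?_⟩
      rcases Nat.lt_succ_iff_lt_or_eq.1 he with h | rfl
      · exact ht s (le_trans (le_max_left _ _) hs) e h ρ hρ
      · have := ht' s (le_trans (le_max_right _ _) hs) ρ hρ
        simp only [gds, gdl]
        exact Bool.eq_iff_iff.2 (by simpa only [decide_eq_true_eq] using this)
  obtain ⟨t, ht⟩ := this
  exact ⟨t, fun s hs => claims_congr κ a E (ht s hs)⟩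

theorem claims_sum (gd : ℕ → List Bool → ℕ → Bool) (κ : List Bool) (a E : ℕ) :
    (((claims gd κ a E).map Prod.snd).map fun c => (1/2 : ℝ)^c.length).sum
      ≤ (1/2)^(a+2) * (1 - (1/2)^E) := by
  induction E with
  | zero => simp [claims]
  | succ n ih =>
    have h2 : ∀ o : Option (List Bool), (∀ ρ ∈ o, ρ ∈ strs (a+n+3)) →
      ((((o.map fun ρ => (n, ρ)).toList).map Prod.snd).map fun c => (1/2 : ℝ)^c.length).sum
        ≤ (1/2)^(a+n+3) := by
      intro o ho
      cases o with
      | none => simp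
      | some ρ => simp [mem_strs.1 (ho ρ rfl)]
    simp only [claims, List.map_append, List.sum_append]
    refine (add_le_add ih (h2 _ fun ρ hρ => List.mem_of_find?_eq_some hρ)).trans (le_of_eq ?_)
    ring

theorem claims_len (gd : ℕ → List Bool → ℕ → Bool) (κ : List Bool) (a E : ℕ) :
    ∀ c ∈ claims gd κ a E, c.2.length ≤ a + E + 2 := by
  induction E with
  | zero => simp [claims]
  | succ n ih =>
    intro c hc
    rcases List.mem_append.1 hc with h | h
    · have := ih c h; omega
    · rw [Option.mem_toList, Option.map_eq_some_iff] at h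
      obtain ⟨ρ, hρ, rfl⟩ := h
      have := mem_strs.1 (List.mem_of_find?_eq_some hρ)
      simp only
      omega

theorem claims_new {e a : ℕ} {κ : List Bool} (hκ : κ.length ≤ a)
    (hG : 3/4*(1/2:ℝ)^a ≤ mu.real (N e ∩ cyl κ)) :
    ∃ ρ, claims gdl κ a (e+1) = claims gdl κ a e ++ [(e, ρ)] ∧ κ <+: ρ ∧ ρ.length = a+e+3 ∧
      Good e ρ (2*a+e+4) ∧ ∀ c ∈ claims gdl κ a e, ¬ c.2 <+: ρ := by
  rcases h : (strs (a+e+3)).find? fun ρ => decide (κ <+: ρ ∧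
      gdl e ρ (2*a+e+4) = true ∧ ∀ c ∈ claims gdl κ a e, ¬ c.2 <+: ρ) with _ | ρ
  · exfalso
    rw [List.find?_eq_none] at h
    have h1 := cover_bound (e := e) (κ := κ) (l := a+e+3) (b := 2*a+e+4)
      ((claims gdl κ a e).map Prod.snd) (by omega) (by
        intro ρ hρ h1 h2
        by_contra h3
        refine h ρ hρ (decide_eq_true ⟨h1, by simpa [gdl] using h2, fun c hc hp => h3 ⟨c.2, ?_, hp⟩⟩)
        exact List.mem_map_of_mem hc)
    have h2 := claims_sum gdl κ a e
    have h3 : (2:ℝ)^(a+e+3) * (1/2)^(2*a+e+4) = (1/2)^(a+1) := by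
      have : 2*a+e+4 = (a+e+3) + (a+1) := by ring
      rw [this, pow_add (1/2:ℝ), ← mul_assoc, ← mul_pow]; norm_num
    rw [h3] at h1
    have h4 : (0:ℝ) < (1/2)^e := by positivity
    have h5 : (0:ℝ) < (1/2)^a := by positivity
    have : (1/2:ℝ)^(a+2) * (1 - (1/2)^e) + (1/2)^(a+1) < 3/4*(1/2:ℝ)^a := by
      rw [pow_add, pow_add]
      nlinarith [mul_pos h4 h5]
    linarith
  · have h1 := List.find?_some h
    have h2 := List.mem_of_find?_eq_some h
    have h1 := of_decide_eq_true h1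
    have h6 : Good e ρ (2*a+e+4) := by simpa [gdl] using h1.2.1
    exact ⟨ρ, by simp only [claims]; rw [h]; rfl, h1.1, mem_strs.1 h2, h6, h1.2.2⟩

theorem step1_works {e a : ℕ} {κ : List Bool} (hκ : κ.length ≤ a)
    (hG : 3/4*(1/2:ℝ)^a ≤ mu.real (N e ∩ cyl κ)) :
    ∃ ρ t, κ <+: ρ ∧ κ.length < ρ.length ∧ Good e ρ (2*a+e+4) ∧
      ∀ τ L, ρ <+: τ → t ≤ τ.length →
        step1 τ κ.length a L = (ρ.length, 2*a+e+4, some (e, 0), L) := by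
  obtain ⟨ρ, h1, h2, h3, h4, h5⟩ := claims_new hκ hG
  obtain ⟨t, ht⟩ := claims_settle κ a (e+1)
  refine ⟨ρ, max t (e+1), h2, by omega, h4, fun τ L hτ hl => ?_⟩
  have hk : τ.take κ.length = κ := (List.prefix_iff_eq_take.1 (h2.trans hτ)).symm
  obtain ⟨r, hr⟩ := claims_prefix (gds τ.length) κ a (le_trans (le_max_right t (e+1)) hl)
  have hf : (claims (gds τ.length) (τ.take κ.length) a τ.length).find?
      (fun c => decide (c.2 <+: τ)) = some (e, ρ) := by
    rw [hk, ← hr, ht _ (le_trans (le_max_left t (e+1)) hl), h1, List.append_assoc,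
      List.find?_append]
    have : (claims gdl κ a e).find? (fun c => decide (c.2 <+: τ)) = none := by
      rw [List.find?_eq_none]
      intro c hc hh
      have hh := of_decide_eq_true hh
      refine h5 c hc (List.prefix_of_prefix_length_le hh hτ ?_)
      have := claims_len gdl κ a e c hc
      omega
    rw [this]
    simp [hτ]
  unfold step1
  rw [hf]


theorem step_L_mono (τ : List Bool) (st : St) : st.2.2.2 <+: (step τ st).2.2.2 := by
  unfold step step1 step2
  split
  · split <;> exact List.prefix_refl _
  · split_ifs <;> first | exact List.prefix_refl _ | exact List.prefix_append _ _

theorem iter_L_mono (τ : List Bool) (st : St) (j : ℕ) :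
    st.2.2.2 <+: ((step τ)^[j] st).2.2.2 := by
  induction j with
  | zero => exact List.prefix_refl _
  | succ n ih =>
    rw [Function.iterate_succ_apply']
    exact ih.trans (step_L_mono _ _)

theorem lr {e a : ℕ} {κ : List Bool} (hG : Good e κ a) :
    ∃ m M t, κ <+: m ∧ κ <+: M ∧ m.length = a+2 ∧ M.length = a+2 ∧ Good e m (2*a+3) ∧
      Good e M (2*a+3) ∧ (∀ s, ¬ isR e s a κ m) ∧ (∀ s, ¬ isL e s a κ M) ∧
      ∀ s ≥ t, isL e s a κ m ∧ isR e s a κ M := by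
  classical
  let G : Finset (List Bool) := ((strs (a+2)).toFinset).filter
    fun ρ => κ <+: ρ ∧ Good e ρ (2*a+3)
  have hG' : ∀ ρ, ρ ∈ G ↔ ρ.length = a+2 ∧ κ <+: ρ ∧ Good e ρ (2*a+3) := by
    intro ρ; simp [G, mem_strs]
  have two : ∀ ρ0 : List Bool, ρ0.length = a+2 → ∃ ρ ∈ G, ρ ≠ ρ0 := by
    intro ρ0 h0
    obtain ⟨ρ, h1, h2, h3, h4⟩ := hG.two_ext ρ0 h0
    exact ⟨ρ, (hG' ρ).2 ⟨mem_strs.1 h1, h2, h3⟩, h4⟩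
  have hne : G.Nonempty := by
    obtain ⟨ρ, h, _⟩ := two (List.replicate (a+2) true) (by simp)
    exact ⟨ρ, h⟩
  obtain ⟨m, hm, hmin⟩ := G.exists_min_image (fun ρ => Encodable.encode ρ) hne
  obtain ⟨M, hM, hmax⟩ := G.exists_max_image (fun ρ => Encodable.encode ρ) hne
  obtain ⟨t, ht⟩ := good_settle e (2*a+3) (strs (a+2))
  have hm' := (hG' m).1 hm
  have hM' := (hG' M).1 hM
  refine ⟨m, M, t, hm'.2.1, hM'.2.1, hm'.1, hM'.1, hm'.2.2, hM'.2.2, ?_, ?_, ?_⟩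
  · rintro s ⟨h1, h2, h3, h4⟩
    obtain ⟨ρ, hρ, hne⟩ := two m hm'.1
    have hρ' := (hG' ρ).1 hρ
    have hs : a + 2 ≤ s := by
      by_contra hs
      exact not_good_short (by omega) h3
    have h5 := h4 ρ (mem_strs.2 hρ'.1) ⟨hρ'.2.1, hρ'.2.2.good (by omega)⟩
    exact hne (Encodable.encode_injective (le_antisymm h5 (hmin ρ hρ)))
  · rintro s ⟨h1, h2, h3, h4⟩
    obtain ⟨ρ, hρ, hne⟩ := two M hM'.1
    have hρ' := (hG' ρ).1 hρ
    have hs : a + 2 ≤ s := by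
      by_contra hs
      exact not_good_short (by omega) h3
    have h5 := h4 ρ (mem_strs.2 hρ'.1) ⟨hρ'.2.1, hρ'.2.2.good (by omega)⟩
    exact hne (Encodable.encode_injective (le_antisymm (hmax ρ hρ) h5))
  · intro s hs
    refine ⟨⟨hm'.1, hm'.2.1, (ht s hs m (mem_strs.2 hm'.1)).2 hm'.2.2, ?_⟩,
      ⟨hM'.1, hM'.2.1, (ht s hs M (mem_strs.2 hM'.1)).2 hM'.2.2, ?_⟩⟩
    · rintro ρ hρ ⟨h1, h2⟩
      exact hmin ρ ((hG' ρ).2 ⟨mem_strs.1 hρ, h1, (ht s hs ρ hρ).1 h2⟩)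
    · rintro ρ hρ ⟨h1, h2⟩
      exact hmax ρ ((hG' ρ).2 ⟨mem_strs.1 hρ, h1, (ht s hs ρ hρ).1 h2⟩)

/-- Good pairs. -/
def GP (e : ℕ) : Type := {p : List Bool × ℕ // Good e p.1 p.2}

/-- The counting state of a good pair. -/
def GP.st {e : ℕ} (p : GP e) (k : ℕ) (L : List ℕ) : St := (p.1.1.length, p.1.2, some (e, k), L)

theorem lr_step {e : ℕ} (p : GP e) : ∃ q r : GP e, ∃ t, p.1.1 <+: q.1.1 ∧ p.1.1 <+: r.1.1 ∧
    p.1.1.length < q.1.1.length ∧ p.1.1.length < r.1.1.length ∧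
    (∀ τ k L, q.1.1 <+: τ → t ≤ τ.length → step τ (p.st k L) = q.st (k+1) L) ∧
    (∀ τ k L, r.1.1 <+: τ → t ≤ τ.length →
      step τ (p.st k L) = (r.1.1.length, r.1.2, none, L ++ [k])) ∧
    (∀ τ k L, p.1.1 <+: τ → (τ <+: q.1.1 ∨ q.1.1 <+: τ) →
      step τ (p.st k L) = p.st k L ∨ (q.1.1 <+: τ ∧ step τ (p.st k L) = q.st (k+1) L)) ∧
    (∀ τ k L, p.1.1 <+: τ → (τ <+: r.1.1 ∨ r.1.1 <+: τ) →
      step τ (p.st k L) = p.st k L ∨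
      (r.1.1 <+: τ ∧ step τ (p.st k L) = (r.1.1.length, r.1.2, none, L ++ [k]))) := by
  obtain ⟨⟨κ, a⟩, hG⟩ := p
  simp only at hG
  have hl := hG.length_le
  obtain ⟨m, M, t, h1, h2, h3, h4, h5, h6, h7, h8, h9⟩ := lr hG
  have tk : ∀ {x τ : List Bool}, x <+: τ → ∀ n, x.length = n → τ.take n = x := by
    rintro x τ h n rfl
    exact (List.prefix_iff_eq_take.1 h).symm
  refine ⟨⟨(m, 2*a+3), h5⟩, ⟨(M, 2*a+3), h6⟩, t, h1, h2, ?_, ?_, ?_, ?_, ?_, ?_⟩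
  · simp only; omega
  · simp only; omega
  · intro τ k L hτ ht
    simp only at hτ
    change step2 τ κ.length a e k L = (m.length, 2*a+3, some (e, k+1), L)
    unfold step2
    rw [tk (h1.trans hτ) _ rfl, tk hτ _ h3, if_pos (h9 _ ht).1, h3]
  · intro τ k L hτ ht
    simp only at hτ
    change step2 τ κ.length a e k L = (M.length, 2*a+3, none, L ++ [k])
    unfold step2
    rw [tk (h2.trans hτ) _ rfl, tk hτ _ h4, if_neg (h8 _), if_pos (h9 _ ht).2, h4]
  · intro τ k L hp hτ
    simp only at hτ hp
    change step2 τ κ.length a e k L = (κ.length, a, some (e, k), L) ∨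
      (m <+: τ ∧ step2 τ κ.length a e k L = (m.length, 2*a+3, some (e, k+1), L))
    unfold step2
    rw [tk hp _ rfl]
    by_cases hh : m <+: τ
    · rw [tk hh _ h3, h3]
      split_ifs with h10 h11
      · exact Or.inr ⟨hh, rfl⟩
      · exact absurd h11 (h7 _)
      · exact Or.inl rfl
    · have hlen : (τ.take (a+2)).length ≠ a+2 := by
        intro hlen
        rcases hτ with hτ | hτ
        · have : τ.length ≤ m.length := hτ.length_le
          have h12 : τ = m := hτ.eq_of_length (by
            rw [List.length_take] at hlen; omega)
          exact hh (h12 ▸ List.prefix_refl _)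
        · exact hh hτ
      rw [if_neg fun h => hlen h.1, if_neg fun h => hlen h.1]
      exact Or.inl rfl
  · intro τ k L hp hτ
    simp only at hτ hp
    change step2 τ κ.length a e k L = (κ.length, a, some (e, k), L) ∨
      (M <+: τ ∧ step2 τ κ.length a e k L = (M.length, 2*a+3, none, L ++ [k]))
    unfold step2
    rw [tk hp _ rfl]
    by_cases hh : M <+: τ
    · rw [tk hh _ h4, h4]
      split_ifs with h10 h11
      · exact absurd h10 (h8 _)
      · exact Or.inr ⟨hh, rfl⟩
      · exact Or.inl rfl
    · have hlen : (τ.take (a+2)).length ≠ a+2 := by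
        intro hlen
        rcases hτ with hτ | hτ
        · have : τ.length ≤ M.length := hτ.length_le
          have h12 : τ = M := hτ.eq_of_length (by
            rw [List.length_take] at hlen; omega)
          exact hh (h12 ▸ List.prefix_refl _)
        · exact hh hτ
      rw [if_neg fun h => hlen h.1, if_neg fun h => hlen h.1]
      exact Or.inl rfl

/-- The sequence of left moves. -/
noncomputable def chain {e : ℕ} (p : GP e) (k : ℕ) : GP e :=
  (fun q => (lr_step q).choose)^[k] p

theorem chain_succ {e : ℕ} (p : GP e) (k : ℕ) :
    chain p (k+1) = (lr_step (chain p k)).choose := by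
  unfold chain; rw [Function.iterate_succ_apply']

theorem chain_prefix {e : ℕ} (p : GP e) (k : ℕ) :
    (chain p k).1.1 <+: (chain p (k+1)).1.1 := by
  rw [chain_succ]
  obtain ⟨r, t, h⟩ := (lr_step (chain p k)).choose_spec
  exact h.1

theorem chain_prefix_le {e : ℕ} (p : GP e) {k l : ℕ} (h : k ≤ l) :
    (chain p k).1.1 <+: (chain p l).1.1 := by
  induction l, h using Nat.le_induction with
  | base => exact List.prefix_refl _
  | succ n _ ih => exact ih.trans (chain_prefix p n)

theorem chain_len {e : ℕ} (p : GP e) (k : ℕ) : k ≤ (chain p k).1.1.length := by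
  induction k with
  | zero => exact Nat.zero_le _
  | succ n ih =>
    rw [chain_succ]
    obtain ⟨r, t, h⟩ := (lr_step (chain p n)).choose_spec
    have := h.2.2.1
    omega

theorem chain_reach {e : ℕ} (p : GP e) (k : ℕ) : ∃ t, ∀ τ L, (chain p k).1.1 <+: τ →
    t ≤ τ.length → (step τ)^[k] (p.st 0 L) = (chain p k).st k L := by
  induction k with
  | zero => exact ⟨0, fun τ L _ _ => rfl⟩
  | succ n ih =>
    obtain ⟨t, ht⟩ := ih
    obtain ⟨r, t', h⟩ := (lr_step (chain p n)).choose_spec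
    refine ⟨max t t', fun τ L hτ hl => ?_⟩
    rw [Function.iterate_succ_apply', ht τ L ((chain_prefix p n).trans hτ)
      (le_trans (le_max_left _ _) hl)]
    rw [chain_succ] at hτ ⊢
    exact h.2.2.2.2.1 τ n L hτ (le_trans (le_max_right _ _) hl)

theorem comp_mono {x y τ : List Bool} (h : x <+: y) (hτ : τ <+: y ∨ y <+: τ) :
    τ <+: x ∨ x <+: τ := by
  rcases hτ with hτ | hτ
  · exact List.prefix_or_prefix_of_prefix hτ h
  · exact Or.inr (h.trans hτ)

theorem iter_two {τ : List Bool} {s s' : St} {P : Prop} (h : step τ s = s ∨ (P ∧ step τ s = s')) (d : ℕ) :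
    (step τ)^[d] s = s ∨ ∃ i ≤ d, P ∧ (step τ)^[i] s = s' := by
  induction d with
  | zero => exact Or.inl rfl
  | succ n ih =>
    rcases ih with ih | ⟨i, hi, ih⟩
    · rcases h with h | ⟨hP, h⟩
      · left; rw [Function.iterate_succ_apply', ih, h]
      · right; exact ⟨n+1, le_refl _, hP, by rw [Function.iterate_succ_apply', ih, h]⟩
    · exact Or.inr ⟨i, by omega, ih⟩

theorem chain_inv {e : ℕ} (p : GP e) (k : ℕ) (τ : List Bool) (L : List ℕ) (hp : p.1.1 <+: τ)
    (hτ : τ <+: (chain p k).1.1 ∨ (chain p k).1.1 <+: τ) (j : ℕ) :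
    ((step τ)^[j] (p.st 0 L)).2.2.2 = L ∨
      ∃ i ≤ j, (chain p k).1.1 <+: τ ∧ (step τ)^[i] (p.st 0 L) = (chain p k).st k L := by
  induction k with
  | zero => exact Or.inr ⟨0, Nat.zero_le _, hp, rfl⟩
  | succ n ih =>
    rcases ih (comp_mono (chain_prefix p n) hτ) with ih | ⟨i, hi, hpre, ih⟩
    · exact Or.inl ih
    · obtain ⟨r, t', h⟩ := (lr_step (chain p n)).choose_spec
      rw [chain_succ] at hτ ⊢
      set q := (lr_step (chain p n)).choose
      have h1 := h.2.2.2.2.2.2.1 τ n L hpre hτ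
      have hadd : ∀ d, (step τ)^[i+d] (p.st 0 L) = (step τ)^[d] ((chain p n).st n L) := by
        intro d; rw [add_comm, Function.iterate_add_apply, ih]
      rcases iter_two h1 (j-i) with h2 | ⟨i', hi', hq, h2⟩
      · left
        rw [← hadd, Nat.add_sub_cancel' hi] at h2
        rw [h2]; rfl
      · right
        exact ⟨i+i', by omega, hq, by rw [hadd, h2]⟩

theorem code_step {e a K t : ℕ} {κ : List Bool} {L : List ℕ} (hκ : κ.length ≤ a)
    (hG : 3/4*(1/2:ℝ)^a ≤ mu.real (N e ∩ cyl κ))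
    (hK : ∀ τ, κ <+: τ → t ≤ τ.length → (step τ)^[K] init = (κ.length, a, none, L)) :
    ∃ (θ : ℕ → List Bool) (t1 : ℕ), t ≤ t1 ∧ κ.length < (θ 0).length ∧ (θ 0).length ≤ t1 ∧
      κ <+: θ 0 ∧ (∀ k l, k ≤ l → θ k <+: θ l) ∧ (∀ k, k ≤ (θ k).length) ∧
      ∀ n, ∃ κ' a' t', θ n <+: κ' ∧ Good e κ' a' ∧ t1 ≤ t' ∧ K+1+n+1 ≤ t' ∧
        (∀ τ, κ' <+: τ → t' ≤ τ.length →
          (step τ)^[K+1+n+1] init = (κ'.length, a', none, L ++ [n])) ∧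
        (∀ τ, θ 0 <+: τ → t1 ≤ τ.length → (τ <+: κ' ∨ κ' <+: τ) →
          (run τ).2.2.2 = L ∨ (L ++ [n]) <+: (run τ).2.2.2) := by
  obtain ⟨ρ, t0, h1, h2, h3, h4⟩ := step1_works hκ hG
  let p : GP e := ⟨(ρ, 2*a+e+4), h3⟩
  let t1 := t + t0 + (K+1) + ρ.length
  have hp : (chain p 0).1.1 = ρ := rfl
  have hstart : ∀ τ, ρ <+: τ → t1 ≤ τ.length → ∀ j, (step τ)^[K+1+j] init =
      (step τ)^[j] (p.st 0 L) := by
    intro τ hτ hl j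
    rw [add_comm, Function.iterate_add_apply, Function.iterate_succ_apply',
      hK τ (h1.trans hτ) (by omega)]
    congr 1
    exact h4 τ L hτ (by omega)
  refine ⟨fun k => (chain p k).1.1, t1, by omega, by simpa only [hp] using h2,
    (show ρ.length ≤ t1 by omega), by simpa only [hp] using h1, fun k l h => chain_prefix_le p h,
    chain_len p, fun n => ?_⟩
  obtain ⟨q, r, t2, g1, g2, g3, g4, g5, g6, g7, g8⟩ := lr_step (chain p n)
  obtain ⟨t3, ht3⟩ := chain_reach p n
  have hρr : ρ <+: r.1.1 := (chain_prefix_le p (Nat.zero_le n)).trans g2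
  refine ⟨r.1.1, r.1.2, t1 + t2 + t3 + n + 1, g2, r.2, by omega, by omega, ?_, ?_⟩
  · intro τ hτ hl
    rw [add_assoc (K+1), hstart τ (hρr.trans hτ) (by omega), Function.iterate_succ_apply',
      ht3 τ L (g2.trans hτ) (by omega)]
    exact g6 τ n L hτ (by omega)
  · intro τ hτ hl hc
    have hτ : ρ <+: τ := hτ
    have hr : run τ = (step τ)^[τ.length - (K+1)] (p.st 0 L) := by
      rw [← hstart τ hτ hl]
      unfold run
      congr 2
      omega
    rw [hr]
    rcases chain_inv p n τ L hτ (comp_mono g2 hc) (τ.length - (K+1)) with h | ⟨i, hi, hq, h⟩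
    · exact Or.inl h
    · have hadd : ∀ d, (step τ)^[i+d] (p.st 0 L) = (step τ)^[d] ((chain p n).st n L) := by
        intro d; rw [add_comm, Function.iterate_add_apply, h]
      generalize hj : τ.length - (K+1) = j at hi ⊢
      rcases iter_two (g8 τ n L hq hc) (j-i) with h5 | ⟨i', hi', _, h5⟩
      · left
        rw [← hadd, Nat.add_sub_cancel' hi] at h5
        rw [h5]; rfl
      · right
        have h6 : (step τ)^[j] (p.st 0 L) = (step τ)^[j - (i+i')]
            (r.1.1.length, r.1.2, none, L ++ [n]) := by
          rw [← h5, ← hadd, ← Function.iterate_add_apply]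
          congr 2
          omega
        rw [h6]
        exact iter_L_mono τ (r.1.1.length, r.1.2, none, L ++ [n]) _

/-! ### The functional -/

/-- The root string coded by a number. -/
def rOf (n : ℕ) : List Bool := (Encodable.decode n.unpair.1 : Option (List Bool)).getD []

/-- The index coded by a number. -/
def iOf (n : ℕ) : ℕ := n.unpair.2.unpair.1

/-- Coding a root, an index, and some padding. -/
def mkn (r : List Bool) (i pad : ℕ) : ℕ := Nat.pair (Encodable.encode r) (Nat.pair i pad)

@[simp] theorem rOf_mkn (r : List Bool) (i pad : ℕ) : rOf (mkn r i pad) = r := by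
  simp [rOf, mkn]

@[simp] theorem iOf_mkn (r : List Bool) (i pad : ℕ) : iOf (mkn r i pad) = i := by
  simp [iOf, mkn]

theorem le_mkn (r : List Bool) (i pad : ℕ) : pad ≤ mkn r i pad :=
  (Nat.right_le_pair _ _).trans (Nat.right_le_pair _ _)

/-- The set of strings determined by a list of codes. -/
def SL (L : List ℕ) : Set (List Bool) := {σ | ∀ n ∈ L, σ ∈ W (iOf n)}

theorem mem_SL {L : List ℕ} {σ : List Bool} : σ ∈ SL L ↔ ∀ n ∈ L, σ ∈ W (iOf n) := Iff.rfl

theorem iOf_prim : Primrec iOf :=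
  Primrec.fst.comp (Primrec.unpair.comp (Primrec.snd.comp Primrec.unpair))

theorem rOf_prim : Primrec rOf :=
  Primrec.option_getD.comp (Primrec.decode.comp (Primrec.fst.comp Primrec.unpair))
    (Primrec.const [])

theorem SL_stage {L : List ℕ} {σ : List Bool} (h : σ ∈ SL L) :
    ∃ s0, ∀ s ≥ s0, ∀ n ∈ L, enumBy (iOf n) s σ = true := by
  induction L with
  | nil => exact ⟨0, by simp⟩
  | cons x L ih =>
    obtain ⟨s1, h1⟩ := ih fun n hn => h n (by simp [hn])
    obtain ⟨s2, h2⟩ := h x (by simp)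
    refine ⟨max s1 s2, fun s hs n hn => ?_⟩
    rcases List.mem_cons.1 hn with rfl | hn
    · exact enumBy_mono (le_trans (le_max_right _ _) hs) h2
    · exact h1 s (le_trans (le_max_left _ _) hs) n hn

theorem SL_re (L : List ℕ) : REPred fun σ => σ ∈ SL L := by
  have h : PrimrecRel fun (σ : List Bool) (s : ℕ) => ∀ n ∈ L, enumBy (iOf n) s σ = true := by
    refine prim_forall (α := List Bool × ℕ) (f := fun _ => L)
      (p := fun x n => enumBy (iOf n) x.2 x.1 = true) (Primrec.const L) ?_
    refine Primrec.eq.comp (enumBy_primrec.comp (Primrec.pair (Primrec.pair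
      (iOf_prim.comp Primrec.snd) (Primrec.snd.comp Primrec.fst))
      (Primrec.fst.comp Primrec.fst))) (Primrec.const true)
  obtain ⟨_, h⟩ := h
  refine (re_of_search (q := fun σ s => decide (∀ n ∈ L, enumBy (iOf n) s σ = true))
    (Primrec.to_comp (h.of_eq fun x => by congr))).of_eq fun σ => ?_
  simp only [decide_eq_true_eq]
  constructor
  · rintro ⟨s, hs⟩ n hn
    exact ⟨s, hs n hn⟩
  · intro hσ
    obtain ⟨s, hs⟩ := SL_stage hσ
    exact ⟨s, hs s (le_refl _)⟩

/-- A valid move. -/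
def okM (σ : List Bool) (L : List ℕ) (s k : ℕ) : Prop :=
  rOf (L.getD k 0) ≠ σ ∧ σ <+: rOf (L.getD k 0) ∧
    ∀ l < k+1, enumBy (iOf (L.getD l 0)) s (rOf (L.getD k 0)) = true

instance (σ : List Bool) (L : List ℕ) (s k : ℕ) : Decidable (okM σ L s k) := by
  unfold okM; infer_instance

/-- Moving. -/
def move (σ : List Bool) (L : List ℕ) (s : ℕ) : List Bool :=
  (((List.range L.length).find? fun k => okM σ L s k).map fun k => rOf (L.getD k 0)).getD σ

/-- Staged computation of the functional. -/
def Fa (τ : List Bool) (n : ℕ) : List Bool :=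
  n.rec [] fun i σ => move σ (run (τ.take (i+1))).2.2.2 (i+1)

/-- The functional. -/
def F (τ : List Bool) : List Bool := Fa τ τ.length

theorem move_prim {α : Type} [Primcodable α] {σ : α → List Bool} {L : α → List ℕ} {s : α → ℕ}
    (hσ : Primrec σ) (hL : Primrec L) (hs : Primrec s) :
    Primrec fun x => move (σ x) (L x) (s x) := by
  refine Primrec.option_getD.comp (Primrec.option_map (prim_find
    (Primrec.list_range.comp (Primrec.list_length.comp hL))
    (p := fun x k => okM (σ x) (L x) (s x) k) ?_) ?_) hσ
  · have hk : Primrec fun z : α × ℕ => rOf ((L z.1).getD z.2 0) :=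
      rOf_prim.comp ((Primrec.list_getD 0).comp (hL.comp Primrec.fst) Primrec.snd)
    refine (Primrec.eq.comp hk (hσ.comp Primrec.fst)).not.and
      ((prim_pfx (hσ.comp Primrec.fst) hk).and ?_)
    refine prim_forall_lt (α := α × ℕ) (f := fun z => z.2 + 1)
      (p := fun z l => enumBy (iOf ((L z.1).getD l 0)) (s z.1) (rOf ((L z.1).getD z.2 0)) = true)
      (Primrec.succ.comp Primrec.snd) ?_
    refine Primrec.eq.comp (enumBy_primrec.comp (Primrec.pair (Primrec.pair
      (iOf_prim.comp ?_) (hs.comp (Primrec.fst.comp Primrec.fst))) (hk.comp Primrec.fst)))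
      (Primrec.const true)
    exact (Primrec.list_getD 0).comp (hL.comp (Primrec.fst.comp Primrec.fst)) Primrec.snd
  · exact rOf_prim.comp ((Primrec.list_getD 0).comp (hL.comp Primrec.fst) Primrec.snd)

theorem F_prim : Primrec F := by
  refine Primrec.nat_rec' (α := List Bool) (β := List Bool) (f := List.length)
    (g := fun _ => []) (h := fun τ y => move y.2 (run (τ.take (y.1+1))).2.2.2 (y.1+1))
    Primrec.list_length (Primrec.const []) ?_
  have h1 : Primrec fun z : List Bool × (ℕ × List Bool) => z.2.1 + 1 :=
    Primrec.succ.comp (Primrec.fst.comp Primrec.snd)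
  refine move_prim (Primrec.snd.comp Primrec.snd) ?_ h1
  exact Primrec.snd.comp (Primrec.snd.comp (Primrec.snd.comp (run_prim.comp
    (Primrec.list_take.comp h1 Primrec.fst))))

theorem Fa_congr {τ τ' : List Bool} {n : ℕ} (h : τ.take n = τ'.take n) : Fa τ n = Fa τ' n := by
  induction n with
  | zero => rfl
  | succ n ih =>
    have h1 : τ.take n = τ'.take n := by
      have := congrArg (List.take n) h
      rwa [List.take_take, List.take_take, min_eq_left (Nat.le_succ n)] at this
    have ih := ih h1
    change move (Fa τ n) _ _ = move (Fa τ' n) _ _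
    rw [ih, h]

theorem F_nil : F [] = [] := rfl

theorem F_snoc (τ : List Bool) (b : Bool) :
    F (τ ++ [b]) = move (F τ) (run (τ ++ [b])).2.2.2 (τ.length + 1) := by
  unfold F
  rw [show (τ ++ [b]).length = τ.length + 1 by simp]
  change move (Fa (τ ++ [b]) τ.length) (run ((τ ++ [b]).take (τ.length + 1))).2.2.2 _ = _
  rw [Fa_congr (τ := τ ++ [b]) (τ' := τ) (by simp),
    List.take_of_length_le (by simp : (τ ++ [b]).length ≤ τ.length + 1)]

theorem move_spec (σ : List Bool) (L : List ℕ) (s : ℕ) :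
    (move σ L s = σ ∧ ∀ k < L.length, ¬ okM σ L s k) ∨
      ∃ k < L.length, okM σ L s k ∧ move σ L s = rOf (L.getD k 0) := by
  unfold move
  rcases h : (List.range L.length).find? fun k => okM σ L s k with _ | k
  · left
    rw [List.find?_eq_none] at h
    exact ⟨rfl, fun k hk hh => h k (List.mem_range.2 hk) (decide_eq_true hh)⟩
  · right
    exact ⟨k, List.mem_range.1 (List.mem_of_find?_eq_some h),
      by simpa using List.find?_some h, rfl⟩

theorem move_pfx (σ : List Bool) (L : List ℕ) (s : ℕ) : σ <+: move σ L s := by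
  rcases move_spec σ L s with h | ⟨k, _, h1, h2⟩
  · rw [h.1]
  · rw [h2]; exact h1.2.1

theorem F_mono {τ τ' : List Bool} (h : τ <+: τ') : F τ <+: F τ' := by
  obtain ⟨r, rfl⟩ := h
  induction r using List.reverseRecOn with
  | nil => simp
  | append_singleton l b ih =>
    rw [← List.append_assoc, F_snoc]
    exact ih.trans (move_pfx _ _ _)

theorem move_moves {σ : List Bool} {L : List ℕ} {s : ℕ} (h : ∃ k < L.length, okM σ L s k) :
    σ.length < (move σ L s).length := by
  rcases move_spec σ L s with h' | ⟨k, _, h1, h2⟩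
  · obtain ⟨k, hk, h⟩ := h
    exact absurd h (h'.2 k hk)
  · rw [h2]
    have h3 := h1.2.1
    rcases lt_or_eq_of_le h3.length_le with h4 | h4
    · exact h4
    · exact absurd (h3.eq_of_length h4).symm h1.1

/-- Perfect sets of strings. -/
def Perf (S : Set (List Bool)) : Prop :=
  ∀ ν ∈ S, ∃ x ∈ S, ∃ y ∈ S, ν <+: x ∧ ν <+: y ∧ ¬ x <+: y ∧ ¬ y <+: x

/-- Forcing conditions. -/
structure Cond where
  κ : List Bool
  a : ℕ
  e : ℕ
  L : List ℕ
  t : ℕ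
  K : ℕ
  r : List Bool
  hgood : Good e κ a
  hKt : K ≤ t
  dec : ∀ τ, κ <+: τ → t ≤ τ.length → (step τ)^[K] init = (κ.length, a, none, L)
  perf : Perf (SL L)
  rmem : r ∈ SL L
  rle : ∀ σ ∈ SL L, r <+: σ
  Lr : ∀ n ∈ L, rOf n <+: r
  fn : ∀ τ, κ <+: τ → t ≤ τ.length → F τ <+: r ∨ F τ ∈ SL L
  last : r = [] ∨ ∃ k < L.length, rOf (L.getD k 0) = r

theorem getD_mem {L : List ℕ} {k : ℕ} (h : k < L.length) : L.getD k 0 ∈ L := by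
  rw [List.getD_eq_getElem _ _ h]; exact List.getElem_mem h

theorem getD_pfx {L L' : List ℕ} (h : L <+: L') {k : ℕ} (hk : k < L.length) :
    L'.getD k 0 = L.getD k 0 := by
  obtain ⟨r, rfl⟩ := h
  rw [List.getD_append _ _ _ _ hk]

theorem comp_mono' {τ x : List Bool} {b : Bool} (h : τ ++ [b] <+: x ∨ x <+: τ ++ [b]) :
    τ <+: x ∨ x <+: τ := by
  rcases h with h | h
  · exact Or.inl ((List.prefix_append _ _).trans h)
  · exact List.prefix_or_prefix_of_prefix (List.prefix_append _ _) h

theorem Cond.ext (C : Cond) (Pe : ℕ → Prop) (Q : Set (List Bool) → Prop)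
    (he : ∃ e', W C.e ⊆ W e' ∧ Pe e' ∧ 3/4*(1/2:ℝ)^C.a ≤ mu.real (N e' ∩ cyl C.κ))
    (hS : ∀ ν ∈ SL C.L, ∃ S' r', (REPred fun σ => σ ∈ S') ∧ S' ⊆ SL C.L ∧ Perf S' ∧ r' ∈ S' ∧
      (∀ σ ∈ S', r' <+: σ) ∧ ν <+: r' ∧ ν.length < r'.length ∧ Q S') :
    ∃ C' : Cond, C.κ <+: C'.κ ∧ C.κ.length < C'.κ.length ∧ C.r <+: C'.r ∧
      C.r.length < C'.r.length ∧ W C.e ⊆ W C'.e ∧ SL C'.L ⊆ SL C.L ∧ Pe C'.e ∧ Q (SL C'.L) := by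
  obtain ⟨e', hW, hPe, hmu⟩ := he
  obtain ⟨θ, t1, h1, h2, h3, h4, h5, h6, h7⟩ := code_step C.hgood.length_le hmu C.dec
  have hd0 : t1 ≤ (θ t1).length := h6 t1
  -- the value of the functional when coding starts
  have hκt1 : C.κ <+: (θ t1).take t1 := by
    rw [List.prefix_take_iff]
    exact ⟨h4.trans (h5 0 t1 (Nat.zero_le _)), by omega⟩
  obtain ⟨ν, hν, hrν, hσν⟩ : ∃ ν ∈ SL C.L, C.r <+: ν ∧ F ((θ t1).take t1) <+: ν := by
    rcases C.fn _ hκt1 (by rw [List.length_take]; omega) with h | h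
    · exact ⟨C.r, C.rmem, List.prefix_refl _, h⟩
    · exact ⟨_, h, C.rle _ h, List.prefix_refl _⟩
  obtain ⟨S', r', hre, hsub, hperf, hr', hmin, hνr, hlt, hQ⟩ := hS ν hν
  obtain ⟨i', hi'⟩ := exists_index hre
  let n := mkn r' i' t1
  have hn : t1 ≤ n := le_mkn r' i' t1
  obtain ⟨κ', a', t', g1, g2, g3, g4, g5, g6⟩ := h7 n
  have hSL : SL (C.L ++ [n]) = S' := by
    ext σ
    simp only [mem_SL, List.mem_append, List.mem_singleton]
    constructor
    · intro h
      have := h n (Or.inr rfl)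
      rw [iOf_mkn] at this
      exact (hi' σ).1 this
    · rintro h m (hm | rfl)
      · exact hsub h m hm
      · rw [iOf_mkn]; exact (hi' σ).2 h
  have hrr : C.r <+: r' := hrν.trans hνr
  have hLr : ∀ m ∈ C.L ++ [n], rOf m <+: r' := by
    intro m hm
    rcases List.mem_append.1 hm with hm | hm
    · exact (C.Lr m hm).trans hrr
    · rw [List.mem_singleton.1 hm, rOf_mkn]
  have hθκ : θ t1 <+: κ' := (h5 t1 n hn).trans g1
  have hθ0 : θ 0 <+: κ' := (h5 0 n (Nat.zero_le _)).trans g1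
  have key : ∀ τ : List Bool, (τ <+: κ' ∨ κ' <+: τ) → t1 ≤ τ.length →
      F τ <+: r' ∨ F τ ∈ S' := by
    intro τ
    induction τ using List.reverseRecOn with
    | nil =>
      intro _ _
      left
      rw [F_nil]; exact List.nil_prefix
    | append_singleton τ b ih =>
      intro hc hl
      have hθτ : θ 0 <+: τ ++ [b] := by
        rcases hc with hc | hc
        · exact List.prefix_of_prefix_length_le hθ0 hc (by omega)
        · exact hθ0.trans hc
      rcases lt_or_eq_of_le hl with hl' | hl'
      · rw [F_snoc]
        rcases move_spec (F τ) (run (τ ++ [b])).2.2.2 (τ.length + 1) with hm | ⟨k, hk, hm1, hm2⟩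
        · rw [hm.1]
          refine ih (comp_mono' hc) ?_
          simp at hl'
          omega
        · rw [hm2]
          rcases g6 (τ ++ [b]) hθτ hl hc with hL | hL
          · left
            rw [hL] at hk ⊢
            exact (C.Lr _ (getD_mem hk)).trans hrr
          · by_cases hk' : k < (C.L ++ [n]).length
            · left
              rw [getD_pfx hL hk']
              exact hLr _ (getD_mem hk')
            · right
              rw [← hSL]
              intro m hm
              obtain ⟨l, hl, rfl⟩ := List.getElem_of_mem hm
              have := hm1.2.2 l (by omega)
              rw [getD_pfx hL hl, List.getD_eq_getElem _ _ hl] at this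
              exact ⟨_, this⟩
      · left
        have : τ ++ [b] = (θ t1).take t1 := by
          have h8 : τ ++ [b] <+: θ t1 := by
            rcases hc with hc | hc
            · exact List.prefix_of_prefix_length_le hc hθκ (by omega)
            · have := hc.length_le
              have h9 := hθκ.length_le
              have h10 : κ' = τ ++ [b] := hc.eq_of_length (by omega)
              have h11 : θ t1 = κ' := hθκ.eq_of_length (by omega)
              rw [h11, h10]
          have := List.prefix_iff_eq_take.1 h8
          rwa [← hl'] at this
        rw [this]
        exact hσν.trans hνr
  refine ⟨{ κ := κ', a := a', e := e', L := C.L ++ [n], t := t', K := C.K+1+n+1, r := r',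
            hgood := g2, hKt := g4, dec := g5, perf := hSL ▸ hperf, rmem := hSL ▸ hr',
            rle := hSL ▸ hmin, Lr := hLr, fn := ?_, last := ?_ }, h4.trans hθ0, ?_, hrr, ?_, hW,
            hSL ▸ hsub, hPe, hSL ▸ hQ⟩
  · intro τ hτ hl
    rw [hSL]
    exact key τ (Or.inr hτ) (by omega)
  · right
    refine ⟨C.L.length, by simp, ?_⟩
    simp [n]
  · have := hθ0.length_le
    simp only
    omega
  · have := hrν.length_le
    simp only
    omega

/-! ### Closure properties of r.e. predicates -/

theorem re_and {α : Type} [Primcodable α] {p q : α → Prop} (hp : REPred p) (hq : REPred q) :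
    REPred fun a => p a ∧ q a := by
  obtain ⟨f, hf, mf, ef⟩ := re_search hp
  obtain ⟨g, hg, mg, eg⟩ := re_search hq
  refine (re_of_search (q := fun a s => f a s && g a s)
    (Primrec.to_comp (Primrec.and.comp hf hg))).of_eq fun a => ?_
  simp only [Bool.and_eq_true, ef, eg]
  constructor
  · rintro ⟨s, h1, h2⟩; exact ⟨⟨s, h1⟩, ⟨s, h2⟩⟩
  · rintro ⟨⟨s, h1⟩, ⟨t, h2⟩⟩
    exact ⟨max s t, mf a s _ (le_max_left _ _) h1, mg a t _ (le_max_right _ _) h2⟩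

/-- Search for a coded witness. -/
def hitOf {α β : Type} [Primcodable β] (q : α × β → ℕ → Bool) (a : α) (m : ℕ) : Bool :=
  ((Encodable.decode m.unpair.1 : Option β).map fun b => q (a, b) m.unpair.2).getD false

theorem hitOf_prim {α β : Type} [Primcodable α] [Primcodable β] {q : α × β → ℕ → Bool}
    (hq : Primrec₂ q) : Primrec₂ (hitOf q) := by
  refine Primrec.option_getD.comp (Primrec.option_map (α := α × ℕ)
    (f := fun z => (Encodable.decode z.2.unpair.1 : Option β))
    (g := fun z b => q (z.1, b) z.2.unpair.2)
    (Primrec.decode.comp (Primrec.fst.comp (Primrec.unpair.comp Primrec.snd))) ?_)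
    (Primrec.const false)
  exact hq.comp (Primrec.pair (Primrec.fst.comp Primrec.fst) Primrec.snd)
    (Primrec.snd.comp (Primrec.unpair.comp (Primrec.snd.comp Primrec.fst)))

theorem hitOf_true {α β : Type} [Primcodable β] {q : α × β → ℕ → Bool} {a : α} {m : ℕ}
    (h : hitOf q a m = true) : ∃ b, (Encodable.decode m.unpair.1 : Option β) = some b ∧
      q (a, b) m.unpair.2 = true := by
  unfold hitOf at h
  rcases hd : (Encodable.decode m.unpair.1 : Option β) with _ | b
  · rw [hd] at h; simp at h
  · rw [hd] at h; exact ⟨b, rfl, h⟩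

theorem exists_hitOf {α β : Type} [Primcodable β] {q : α × β → ℕ → Bool} {a : α} {b : β} {s : ℕ}
    (h : q (a, b) s = true) : hitOf q a (Nat.pair (Encodable.encode b) s) = true := by
  simp [hitOf, h]

theorem re_exists {α β : Type} [Primcodable α] [Primcodable β] {p : α × β → Prop}
    (hp : REPred p) : REPred fun a => ∃ b, p (a, b) := by
  obtain ⟨q, hq, _, eq⟩ := re_search hp
  refine (re_of_search (hitOf_prim hq).to_comp).of_eq fun a => ?_
  constructor
  · rintro ⟨m, hm⟩
    obtain ⟨b, _, hb⟩ := hitOf_true hm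
    exact ⟨b, (eq _).2 ⟨_, hb⟩⟩
  · rintro ⟨b, hb⟩
    obtain ⟨s, hs⟩ := (eq _).1 hb
    exact ⟨_, exists_hitOf hs⟩

/-- The minimality requirement. -/
def ReqMin (c : OracleCode) (S : Set (List Bool)) : Prop :=
  ∀ M : ℕ → Bool, (∀ n, ∃ k ≥ n, pre M k ∈ S) → ∀ Z, c.eval (chi M) = chi Z →
    ComputableSeq Z ∨ TRed M Z

theorem Perf.above {S : Set (List Bool)} (hP : Perf S) (r : List Bool) :
    Perf {μ | μ ∈ S ∧ r <+: μ} := by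
  rintro ν ⟨hν, hr⟩
  obtain ⟨x, hx, y, hy, h1, h2, h3, h4⟩ := hP ν hν
  exact ⟨x, ⟨hx, hr.trans h1⟩, y, ⟨hy, hr.trans h2⟩, h1, h2, h3, h4⟩

theorem re_above {S : Set (List Bool)} (hre : REPred fun σ => σ ∈ S) (r : List Bool) :
    REPred fun σ => σ ∈ {μ | μ ∈ S ∧ r <+: μ} :=
  re_and hre (prim_pfx (Primrec.const r) Primrec.id).computablePred.to_re

theorem nosplit_req {S : Set (List Bool)} (hre : REPred fun σ => σ ∈ S) {c : OracleCode}
    (h : ∀ x ∈ S, ∀ y ∈ S, ¬ SplitPair c x y) : ReqMin c S := by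
  intro M hM Z hZ
  left
  have hR : REPred fun x : ℕ × ℕ => ∃ μ : List Bool, μ ∈ S ∧ x.2 ∈ c.eval (strOracle μ) x.1 := by
    refine re_exists (p := fun z : (ℕ × ℕ) × List Bool => z.2 ∈ S ∧
      z.1.2 ∈ c.eval (strOracle z.2) z.1.1) (re_and (re_comp hre Computable.snd) ?_)
    exact re_comp (re_mem (eval_str_partrec c)) (f := fun z : (ℕ × ℕ) × List Bool =>
      ((z.2, z.1.1), z.1.2)) (Computable.pair (Computable.pair Computable.snd
        (Computable.fst.comp Computable.fst)) (Computable.snd.comp Computable.fst))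
  have key : ∀ n b, Z n = b ↔ ∃ μ : List Bool, μ ∈ S ∧ (cond b 1 0) ∈ c.eval (strOracle μ) n := by
    have h0 : ∀ n, ∃ μ : List Bool, μ ∈ S ∧ (cond (Z n) 1 0) ∈ c.eval (strOracle μ) n := by
      intro n
      have : (cond (Z n) 1 0) ∈ c.eval (chi M) n := by rw [hZ]; exact Part.mem_some _
      obtain ⟨k, hk⟩ := eval_chi_pre c this
      obtain ⟨j, hj, hjS⟩ := hM k
      exact ⟨_, hjS, hk j hj⟩
    intro n b
    constructor
    · rintro rfl; exact h0 n
    · rintro ⟨μ, hμ, hb⟩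
      obtain ⟨μ', hμ', hz⟩ := h0 n
      by_contra hne
      refine h μ hμ μ' hμ' ⟨n, _, _, hb, hz, ?_⟩
      cases b <;> cases hzn : Z n <;> simp_all
  apply ComputableSeq.of_computable
  have hc : ComputablePred fun n => Z n = true := by
    rw [ComputablePred.computable_iff_re_compl_re']
    constructor
    · exact (re_comp hR (f := fun n => (n, 1)) (Computable.pair Computable.id
        (Computable.const 1))).of_eq fun n => (key n true).symm
    · refine (re_comp hR (f := fun n => (n, 0)) (Computable.pair Computable.id
        (Computable.const 0))).of_eq fun n => ?_
      rw [Bool.not_eq_true]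
      exact (key n false).symm
  obtain ⟨_, hc⟩ := hc
  exact hc.of_eq fun n => by simp

/-- Data for effectively finding splittings. -/
structure Spl (S : Set (List Bool)) (ν : List Bool) (c : OracleCode) where
  hit : List Bool → ℕ → Bool
  y0 : ℕ → List Bool
  y1 : ℕ → List Bool
  nn : ℕ → ℕ
  v0 : ℕ → ℕ
  v1 : ℕ → ℕ
  hit_prim : Primrec₂ hit
  y0_prim : Primrec y0
  y1_prim : Primrec y1
  nn_prim : Primrec nn
  v0_prim : Primrec v0
  v1_prim : Primrec v1
  hyp : ∀ x m, hit x m = true → y0 m ∈ S ∧ y1 m ∈ S ∧ x <+: y0 m ∧ x <+: y1 m ∧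
    v0 m ∈ c.eval (strOracle (y0 m)) (nn m) ∧ v1 m ∈ c.eval (strOracle (y1 m)) (nn m) ∧
    v0 m ≠ v1 m
  tot : ∀ x ∈ S, ν <+: x → ∃ m, hit x m = true

theorem exists_spl {S : Set (List Bool)} (hre : REPred fun σ => σ ∈ S) {ν : List Bool}
    {c : OracleCode} (h : ∀ x ∈ S, ν <+: x → ∃ y0 ∈ S, ∃ y1 ∈ S, x <+: y0 ∧ x <+: y1 ∧
      SplitPair c y0 y1) : Nonempty (Spl S ν c) := by
  let B : Type := (List Bool × List Bool) × (ℕ × (ℕ × ℕ))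
  let p : List Bool × B → Prop := fun z => (z.2.1.1 ∈ S ∧ z.2.1.2 ∈ S) ∧
    ((z.1 <+: z.2.1.1 ∧ z.1 <+: z.2.1.2 ∧ z.2.2.2.1 ≠ z.2.2.2.2) ∧
    (z.2.2.2.1 ∈ c.eval (strOracle z.2.1.1) z.2.2.1 ∧
      z.2.2.2.2 ∈ c.eval (strOracle z.2.1.2) z.2.2.1))
  have f1 : Primrec fun z : List Bool × B => z.1 := Primrec.fst
  have f20 : Primrec fun z : List Bool × B => z.2 := Primrec.snd
  have f2 : Primrec fun z : List Bool × B => z.2.1.1 := Primrec.fst.comp (Primrec.fst.comp f20)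
  have f3 : Primrec fun z : List Bool × B => z.2.1.2 := Primrec.snd.comp (Primrec.fst.comp f20)
  have f4 : Primrec fun z : List Bool × B => z.2.2.1 := Primrec.fst.comp (Primrec.snd.comp f20)
  have f5 : Primrec fun z : List Bool × B => z.2.2.2.1 :=
    Primrec.fst.comp (Primrec.snd.comp (Primrec.snd.comp f20))
  have f6 : Primrec fun z : List Bool × B => z.2.2.2.2 :=
    Primrec.snd.comp (Primrec.snd.comp (Primrec.snd.comp f20))
  have hp : REPred p := by
    refine re_and (re_and (re_comp hre f2.to_comp) (re_comp hre f3.to_comp)) (re_and ?_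
      (re_and ?_ ?_))
    · exact ((prim_pfx f1 f2).and ((prim_pfx f1 f3).and
        (Primrec.eq.comp f5 f6).not)).computablePred.to_re
    · exact re_comp (re_mem (eval_str_partrec c)) (f := fun z : List Bool × B =>
        ((z.2.1.1, z.2.2.1), z.2.2.2.1)) (Primrec.pair (Primrec.pair f2 f4) f5).to_comp
    · exact re_comp (re_mem (eval_str_partrec c)) (f := fun z : List Bool × B =>
        ((z.2.1.2, z.2.2.1), z.2.2.2.2)) (Primrec.pair (Primrec.pair f3 f4) f6).to_comp
  obtain ⟨q, hq, _, eq⟩ := re_search hp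
  let w : ℕ → B := fun m => (Encodable.decode m.unpair.1 : Option B).getD (([], []), (0, (0, 0)))
  have hw : Primrec w := Primrec.option_getD.comp
    (Primrec.decode.comp (Primrec.fst.comp Primrec.unpair)) (Primrec.const _)
  refine ⟨{ hit := hitOf q, y0 := fun m => (w m).1.1, y1 := fun m => (w m).1.2,
            nn := fun m => (w m).2.1, v0 := fun m => (w m).2.2.1, v1 := fun m => (w m).2.2.2,
            hit_prim := hitOf_prim hq, y0_prim := Primrec.fst.comp (Primrec.fst.comp hw),
            y1_prim := Primrec.snd.comp (Primrec.fst.comp hw),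
            nn_prim := Primrec.fst.comp (Primrec.snd.comp hw),
            v0_prim := Primrec.fst.comp (Primrec.snd.comp (Primrec.snd.comp hw)),
            v1_prim := Primrec.snd.comp (Primrec.snd.comp (Primrec.snd.comp hw)),
            hyp := ?_, tot := ?_ }⟩
  · intro x m hm
    obtain ⟨b, hb, hs⟩ := hitOf_true hm
    have hwm : w m = b := by simp only [w]; rw [hb]; rfl
    obtain ⟨⟨h1, h2⟩, ⟨h3, h4, h5⟩, h6, h7⟩ := (eq _).2 ⟨_, hs⟩
    simp only [hwm]
    exact ⟨h1, h2, h3, h4, h6, h7, h5⟩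
  · intro x hx hν
    obtain ⟨y0, hy0, y1, hy1, h1, h2, n, v0, v1, h3, h4, h5⟩ := h x hx hν
    obtain ⟨s, hs⟩ := (eq (x, ((y0, y1), (n, (v0, v1))))).1 ⟨⟨hy0, hy1⟩, ⟨h1, h2, h5⟩, h3, h4⟩
    exact ⟨_, exists_hitOf hs⟩

namespace Spl

variable {S : Set (List Bool)} {ν : List Bool} {c : OracleCode} (D : Spl S ν c)

/-- Bounded search for a splitting. -/
def H (s : ℕ) (x : List Bool) : Option ℕ := (List.range s).find? fun m => D.hit x m

theorem H_prim : Primrec₂ D.H :=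
  (prim_find (α := ℕ × List Bool) (f := fun z => List.range z.1)
    (p := fun z m => D.hit z.2 m = true) (Primrec.list_range.comp Primrec.fst)
    (Primrec.eq.comp (D.hit_prim.comp (Primrec.snd.comp Primrec.fst) Primrec.snd)
      (Primrec.const true))).of_eq fun z => by simp [H]

theorem H_hit {s m : ℕ} {x : List Bool} (h : D.H s x = some m) : D.hit x m = true :=
  List.find?_some h

theorem H_mono {s t m : ℕ} {x : List Bool} (hst : s ≤ t) (h : D.H s x = some m) :
    D.H t x = some m := by
  obtain ⟨k, rfl⟩ := Nat.exists_eq_add_of_le hst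
  unfold H at *
  rw [List.range_add, List.find?_append, h]
  rfl

theorem H_unique {s t m m' : ℕ} {x : List Bool} (h : D.H s x = some m) (h' : D.H t x = some m') :
    m = m' := by
  have h1 := D.H_mono (le_max_left s t) h
  have h2 := D.H_mono (le_max_right s t) h'
  rw [h1] at h2
  exact Option.some.inj h2

theorem H_tot {x : List Bool} (hx : x ∈ S) (hν : ν <+: x) : ∃ s m, D.H s x = some m := by
  obtain ⟨m, hm⟩ := D.tot x hx hν
  have : (D.H (m+1) x).isSome = true := by
    unfold H
    rw [List.find?_isSome]
    exact ⟨m, by simp, hm⟩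
  obtain ⟨m', hm'⟩ := Option.isSome_iff_exists.1 this
  exact ⟨_, _, hm'⟩

theorem incomp {x : List Bool} {m : ℕ} (h : D.hit x m = true) :
    ¬ D.y0 m <+: D.y1 m ∧ ¬ D.y1 m <+: D.y0 m := by
  obtain ⟨_, _, _, _, h1, h2, h3⟩ := D.hyp x m h
  constructor
  · intro hp
    exact h3 (Part.mem_unique (eval_str_mono hp c _ _ h1) h2)
  · intro hp
    exact h3 (Part.mem_unique h1 (eval_str_mono hp c _ _ h2))

/-- Children in the splitting tree. -/
def child (x y : List Bool) : Prop := ∃ s m, D.H s x = some m ∧ (y = D.y0 m ∨ y = D.y1 m)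

/-- The splitting tree. -/
def tree : Set (List Bool) := {μ | Relation.ReflTransGen D.child ν μ}

theorem child_props {x y : List Bool} (h : D.child x y) :
    y ∈ S ∧ x <+: y ∧ x.length < y.length := by
  obtain ⟨s, m, hm, hy⟩ := h
  have hh := D.H_hit hm
  obtain ⟨i1, i2⟩ := D.incomp hh
  obtain ⟨h1, h2, h3, h4, _⟩ := D.hyp x m hh
  rcases hy with rfl | rfl
  · refine ⟨h1, h3, ?_⟩
    rcases lt_or_eq_of_le h3.length_le with h | h
    · exact h
    · exact absurd ((h3.eq_of_length h) ▸ h4) i1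
  · refine ⟨h2, h4, ?_⟩
    rcases lt_or_eq_of_le h4.length_le with h | h
    · exact h
    · exact absurd ((h4.eq_of_length h) ▸ h3) i2

theorem reach_prefix {x y : List Bool} (h : Relation.ReflTransGen D.child x y) : x <+: y := by
  induction h with
  | refl => exact List.prefix_refl _
  | tail _ h ih => exact ih.trans (D.child_props h).2.1

theorem tree_sub (hν : ν ∈ S) : D.tree ⊆ S := by
  intro μ hμ
  cases hμ with
  | refl => exact hν
  | tail _ h => exact (D.child_props h).1

/-- Staged enumeration of the tree. -/
def T (s : ℕ) : List (List Bool) :=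
  s.rec [ν] fun s l => l ++ l.flatMap fun x =>
    ((D.H s x).map fun m => [D.y0 m, D.y1 m]).getD []

theorem T_succ (s : ℕ) : D.T (s+1) = D.T s ++ (D.T s).flatMap fun x =>
    ((D.H s x).map fun m => [D.y0 m, D.y1 m]).getD [] := rfl

theorem T_prim : Primrec D.T := by
  refine Primrec.nat_rec₁ _ (f := fun (s : ℕ) (l : List (List Bool)) => l ++ l.flatMap fun x =>
    ((D.H s x).map fun m => [D.y0 m, D.y1 m]).getD []) ?_
  refine Primrec.list_append.comp Primrec.snd (Primrec.list_flatMap Primrec.snd ?_)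
  refine Primrec.option_getD.comp (Primrec.option_map (D.H_prim.comp
    (Primrec.fst.comp Primrec.fst) Primrec.snd) ?_) (Primrec.const [])
  exact Primrec.list_cons.comp (D.y0_prim.comp Primrec.snd) (Primrec.list_cons.comp
    (D.y1_prim.comp Primrec.snd) (Primrec.const []))

theorem T_sub {s : ℕ} {μ : List Bool} (h : μ ∈ D.T s) : μ ∈ D.tree := by
  induction s generalizing μ with
  | zero =>
    have : μ = ν := by simpa [T] using h
    rw [this]; exact Relation.ReflTransGen.refl
  | succ s ih =>
    rw [T_succ, List.mem_append, List.mem_flatMap] at h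
    rcases h with h | ⟨x, hx, h⟩
    · exact ih h
    · rcases hm : D.H s x with _ | m
      · rw [hm] at h; simp at h
      · rw [hm] at h
        refine Relation.ReflTransGen.tail (ih hx) ⟨s, m, hm, ?_⟩
        simpa using h

theorem T_mono {s t : ℕ} (h : s ≤ t) {μ : List Bool} (hμ : μ ∈ D.T s) : μ ∈ D.T t := by
  induction t, h using Nat.le_induction with
  | base => exact hμ
  | succ n _ ih => rw [T_succ]; exact List.mem_append_left _ ih

theorem mem_tree_iff (μ : List Bool) : μ ∈ D.tree ↔ ∃ s, μ ∈ D.T s := by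
  constructor
  · intro h
    change Relation.ReflTransGen D.child ν μ at h
    induction h with
    | refl => exact ⟨0, by simp [T]⟩
    | @tail x y _ h ih =>
      obtain ⟨s, hs⟩ := ih
      obtain ⟨t, m, hm, hy⟩ := h
      refine ⟨max s t + 1, ?_⟩
      rw [T_succ]
      refine List.mem_append_right _ (List.mem_flatMap.2 ⟨x, D.T_mono (le_max_left _ _) hs, ?_⟩)
      rw [D.H_mono (le_max_right s t) hm]
      simpa using hy
  · rintro ⟨s, hs⟩; exact D.T_sub hs

theorem tree_re : REPred fun μ => μ ∈ D.tree := by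
  have h : PrimrecPred fun z : List Bool × ℕ => ∃ x ∈ D.T z.2, x = z.1 :=
    prim_exists (α := List Bool × ℕ) (f := fun z => D.T z.2) (p := fun z x => x = z.1)
      (D.T_prim.comp Primrec.snd) (Primrec.eq.comp Primrec.snd (Primrec.fst.comp Primrec.fst))
  refine (re_exists h.computablePred.to_re).of_eq fun μ => ?_
  rw [mem_tree_iff]
  simp

theorem tree_perf (hν : ν ∈ S) : Perf D.tree := by
  intro x hx
  obtain ⟨s, m, hm⟩ := D.H_tot (D.tree_sub hν hx) (D.reach_prefix hx)
  have c0 : D.child x (D.y0 m) := ⟨s, m, hm, Or.inl rfl⟩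
  have c1 : D.child x (D.y1 m) := ⟨s, m, hm, Or.inr rfl⟩
  obtain ⟨i1, i2⟩ := D.incomp (D.H_hit hm)
  exact ⟨_, Relation.ReflTransGen.tail hx c0, _, Relation.ReflTransGen.tail hx c1,
    (D.child_props c0).2.1, (D.child_props c1).2.1, i1, i2⟩

/-- Choosing the branch. -/
def pick (m : ℕ) (x : List Bool) (b : Bool) : List Bool :=
  if D.v0 m = cond b 1 0 then D.y0 m else if D.v1 m = cond b 1 0 then D.y1 m else x

/-- One step of the inverse functional. -/
def gstep (τ : List Bool) (x : List Bool) : List Bool :=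
  ((D.H τ.length x).bind fun m => (τ[D.nn m]?).map fun b => D.pick m x b).getD x

/-- The inverse functional. -/
def G (τ : List Bool) : List Bool := (D.gstep τ)^[τ.length] ν

theorem gstep_prim : Primrec₂ D.gstep := by
  refine Primrec.option_getD.comp (Primrec.option_bind (α := List Bool × List Bool)
    (f := fun z => D.H z.1.length z.2)
    (g := fun z m => (z.1[D.nn m]?).map fun b => D.pick m z.2 b) ?_ ?_) Primrec.snd
  · exact D.H_prim.comp (Primrec.list_length.comp Primrec.fst) Primrec.snd
  · refine Primrec.option_map (α := (List Bool × List Bool) × ℕ)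
      (f := fun z => z.1.1[D.nn z.2]?) (g := fun z b => D.pick z.2 z.1.2 b) ?_ ?_
    · exact Primrec.list_getElem?.comp (Primrec.fst.comp Primrec.fst) (D.nn_prim.comp Primrec.snd)
    · have hm : Primrec fun z : ((List Bool × List Bool) × ℕ) × Bool => z.1.2 :=
        Primrec.snd.comp Primrec.fst
      have hb : Primrec fun z : ((List Bool × List Bool) × ℕ) × Bool => (cond z.2 1 0 : ℕ) :=
        Primrec.cond Primrec.snd (Primrec.const 1) (Primrec.const 0)
      exact Primrec.ite (Primrec.eq.comp (D.v0_prim.comp hm) hb) (D.y0_prim.comp hm)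
        (Primrec.ite (Primrec.eq.comp (D.v1_prim.comp hm) hb) (D.y1_prim.comp hm)
          (Primrec.snd.comp (Primrec.fst.comp Primrec.fst)))

theorem G_prim : Primrec D.G :=
  Primrec.nat_iterate Primrec.list_length (Primrec.const ν) D.gstep_prim

/-- The path invariant. -/
def Inv (M : ℕ → Bool) (x : List Bool) : Prop :=
  ∀ n, ∃ k ≥ n, Relation.ReflTransGen D.child x (pre M k)

theorem Inv.eq_pre {M : ℕ → Bool} {x : List Bool} (h : D.Inv M x) : x = pre M x.length := by
  obtain ⟨k, _, hk⟩ := h 0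
  exact ((prefix_pre_iff M x k).1 (D.reach_prefix hk)).1

theorem pick_eq {M Z : ℕ → Bool} (hZ : c.eval (chi M) = chi Z) {x : List Bool} {s m : ℕ}
    (h : D.Inv M x) (hm : D.H s x = some m) :
    D.Inv M (D.pick m x (Z (D.nn m))) ∧ D.child x (D.pick m x (Z (D.nn m))) := by
  obtain ⟨_, _, _, _, g0, g1, gne⟩ := D.hyp x m (D.H_hit hm)
  have hv : ∀ y v, y = pre M y.length → v ∈ c.eval (strOracle y) (D.nn m) →
      v = cond (Z (D.nn m)) 1 0 := by
    intro y v hy hv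
    rw [hy] at hv
    have := eval_pre_chi c hv
    rw [hZ] at this
    exact Part.mem_some_iff.1 this
  have hor : D.Inv M (D.y0 m) ∨ D.Inv M (D.y1 m) := by
    by_contra hcon
    push Not at hcon
    obtain ⟨h0, h1⟩ := hcon
    unfold Inv at h0 h1
    push Not at h0 h1
    obtain ⟨n0, h0⟩ := h0
    obtain ⟨n1, h1⟩ := h1
    obtain ⟨k, hk, hr⟩ := h (max (max n0 n1) (x.length + 1))
    rcases Relation.ReflTransGen.cases_head hr with heq | ⟨y, hy, hyr⟩
    · have := congrArg List.length heq
      rw [pre_length] at this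
      omega
    · obtain ⟨s', m', hm', hy⟩ := hy
      obtain rfl := D.H_unique hm hm'
      rcases hy with rfl | rfl
      · exact h0 k (by omega) hyr
      · exact h1 k (by omega) hyr
  rcases hor with h0 | h1
  · have : D.pick m x (Z (D.nn m)) = D.y0 m := by
      unfold pick
      rw [if_pos (hv _ _ (Inv.eq_pre D h0) g0)]
    rw [this]
    exact ⟨h0, s, m, hm, Or.inl rfl⟩
  · have : D.pick m x (Z (D.nn m)) = D.y1 m := by
      have h2 := hv _ _ (Inv.eq_pre D h1) g1
      unfold pick
      rw [if_neg (fun h3 => gne (h3.trans h2.symm)), if_pos h2]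
    rw [this]
    exact ⟨h1, s, m, hm, Or.inr rfl⟩

theorem gstep_inv {M Z : ℕ → Bool} (hZ : c.eval (chi M) = chi Z) {x : List Bool} (s : ℕ)
    (h : D.Inv M x) : D.Inv M (D.gstep (pre Z s) x) ∧ x <+: D.gstep (pre Z s) x := by
  unfold gstep
  rcases hm : D.H (pre Z s).length x with _ | m
  · exact ⟨h, List.prefix_refl _⟩
  · rcases hb : (pre Z s)[D.nn m]? with _ | b
    · simp only [Option.bind_some, hb, Option.map_none, Option.getD_none]
      exact ⟨h, List.prefix_refl _⟩
    · simp only [Option.bind_some, hb, Option.map_some, Option.getD_some]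
      have hbz : Z (D.nn m) = b := by
        obtain ⟨hl, hb⟩ := List.getElem?_eq_some_iff.1 hb
        simpa [pre] using hb
      obtain ⟨h1, h2⟩ := D.pick_eq hZ h hm
      rw [hbz] at h1 h2
      exact ⟨h1, (D.child_props h2).2.1⟩

theorem iter_inv {M Z : ℕ → Bool} (hZ : c.eval (chi M) = chi Z) {x : List Bool} (s j : ℕ)
    (h : D.Inv M x) : D.Inv M ((D.gstep (pre Z s))^[j] x) ∧ x <+: (D.gstep (pre Z s))^[j] x := by
  induction j with
  | zero => exact ⟨h, List.prefix_refl _⟩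
  | succ n ih =>
    rw [Function.iterate_succ_apply']
    obtain ⟨h1, h2⟩ := D.gstep_inv hZ s ih.1
    exact ⟨h1, ih.2.trans h2⟩

theorem tree_req (hν : ν ∈ S) : ReqMin c D.tree := by
  intro M hM Z hZ
  right
  have h0 : D.Inv M ν := hM
  refine TRed_of_list D.G D.G_prim.to_comp ?_ ?_
  · intro s i b hb
    have h1 := Inv.eq_pre D (D.iter_inv hZ s s h0).1
    have h2 : D.G (pre Z s) = (D.gstep (pre Z s))^[s] ν := by unfold G; rw [pre_length]
    rw [h2, h1] at hb
    obtain ⟨hl, hb⟩ := List.getElem?_eq_some_iff.1 hb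
    simpa [pre] using hb
  · have key : ∀ i, ∃ s0 j x, D.Inv M x ∧ x ∈ D.tree ∧ i ≤ x.length ∧
        ∀ s ≥ s0, (D.gstep (pre Z s))^[j] ν = x := by
      intro i
      induction i with
      | zero => exact ⟨0, 0, ν, h0, Relation.ReflTransGen.refl, Nat.zero_le _, fun _ _ => rfl⟩
      | succ i ih =>
        obtain ⟨s0, j, x, hx, hxt, hl, hs⟩ := ih
        obtain ⟨s1, m, hm⟩ := D.H_tot (D.tree_sub hν hxt) (D.reach_prefix hxt)
        obtain ⟨h1, h2⟩ := D.pick_eq hZ hx hm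
        refine ⟨s0 + s1 + D.nn m + 1, j+1, D.pick m x (Z (D.nn m)), h1,
          Relation.ReflTransGen.tail hxt h2, ?_, fun s hss => ?_⟩
        · have := (D.child_props h2).2.2
          omega
        · rw [Function.iterate_succ_apply', hs s (by omega)]
          unfold gstep
          have hb : (pre Z s)[D.nn m]? = some (Z (D.nn m)) := by
            rw [List.getElem?_eq_some_iff]
            exact ⟨by rw [pre_length]; omega, by simp [pre]⟩
          rw [pre_length, D.H_mono (by omega : s1 ≤ s) hm]
          simp only [Option.bind_some, hb, Option.map_some, Option.getD_some]
    intro n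
    obtain ⟨s0, j, x, hx, _, hl, hs⟩ := key (n+1)
    refine ⟨s0 + j, ?_⟩
    have h2 : D.G (pre Z (s0+j)) = (D.gstep (pre Z (s0+j)))^[s0] x := by
      rw [← hs (s0+j) (by omega), ← Function.iterate_add_apply]
      unfold G; rw [pre_length]
    rw [h2]
    have := (D.iter_inv hZ (s0+j) s0 hx).2.length_le
    omega

end Spl

theorem sacks_min {S : Set (List Bool)} (hre : REPred fun σ => σ ∈ S) (hP : Perf S)
    {ν : List Bool} (hν : ν ∈ S) (c : OracleCode) :
    ∃ S' r', (REPred fun σ => σ ∈ S') ∧ S' ⊆ S ∧ Perf S' ∧ r' ∈ S' ∧ (∀ σ ∈ S', r' <+: σ) ∧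
      ν <+: r' ∧ ReqMin c S' := by
  by_cases h : ∀ x ∈ S, ν <+: x → ∃ y0 ∈ S, ∃ y1 ∈ S, x <+: y0 ∧ x <+: y1 ∧ SplitPair c y0 y1
  · obtain ⟨D⟩ := exists_spl hre h
    exact ⟨D.tree, ν, D.tree_re, D.tree_sub hν, D.tree_perf hν, Relation.ReflTransGen.refl,
      fun σ hσ => D.reach_prefix hσ, List.prefix_refl _, D.tree_req hν⟩
  · push Not at h
    obtain ⟨x, hx, hνx, h⟩ := h
    refine ⟨{μ | μ ∈ S ∧ x <+: μ}, x, re_above hre x, fun μ hμ => hμ.1, hP.above x,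
      ⟨hx, List.prefix_refl _⟩, fun σ hσ => hσ.2, hνx, ?_⟩
    exact nosplit_req (re_above hre x) fun y hy z hz => h y hy.1 z hz.1 hy.2 hz.2

/-- The requirement handled at each step. -/
def Req (c : OracleCode) (S : Set (List Bool)) : Prop :=
  ReqMin c S ∧ ∀ M : ℕ → Bool, (∀ n, ∃ k ≥ n, pre M k ∈ S) →
    c.eval (chi fun _ => false) ≠ chi M

theorem chi_inj {X Y : ℕ → Bool} (h : chi X = chi Y) : X = Y := by
  funext n
  have := congrFun h n
  simp only [chi, Part.some_inj] at this
  cases hx : X n <;> cases hy : Y n <;> simp_all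

theorem sacks {S : Set (List Bool)} (hre : REPred fun σ => σ ∈ S) (hP : Perf S)
    {ν : List Bool} (hν : ν ∈ S) (c : OracleCode) :
    ∃ S' r', (REPred fun σ => σ ∈ S') ∧ S' ⊆ S ∧ Perf S' ∧ r' ∈ S' ∧ (∀ σ ∈ S', r' <+: σ) ∧
      ν <+: r' ∧ ν.length < r'.length ∧ Req c S' := by
  obtain ⟨x, hx, y, hy, h1, h2, h3, h4⟩ := hP ν hν
  have len : ∀ u v : List Bool, ν <+: u → ν <+: v → ¬ u <+: v → ν.length < u.length := by
    intro u v hu hv huv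
    rcases lt_or_eq_of_le hu.length_le with h | h
    · exact h
    · exact absurd ((hu.eq_of_length h) ▸ hv) huv
  obtain ⟨r, hr, hνr, hlr, hav⟩ : ∃ r ∈ S, ν <+: r ∧ ν.length < r.length ∧
      ∀ C : ℕ → Bool, c.eval (chi fun _ => false) = chi C → r ≠ pre C r.length := by
    by_cases hC : ∃ C : ℕ → Bool, c.eval (chi fun _ => false) = chi C ∧ x = pre C x.length
    · obtain ⟨C, hC, hxC⟩ := hC
      refine ⟨y, hy, h2, len y x h2 h1 h4, fun C' hC' hyC => ?_⟩
      obtain rfl := chi_inj (hC.symm.trans hC')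
      rcases le_total x.length y.length with hl | hl
      · exact h3 (by rw [hxC, hyC]; exact pre_pfx C hl)
      · exact h4 (by rw [hxC, hyC]; exact pre_pfx C hl)
    · push Not at hC
      exact ⟨x, hx, h1, len x y h1 h2 h3, hC⟩
  obtain ⟨S', r', g1, g2, g3, g4, g5, g6, g7⟩ := sacks_min hre hP hr c
  refine ⟨S', r', g1, g2, g3, g4, g5, hνr.trans g6, lt_of_lt_of_le hlr g6.length_le, g7, ?_⟩
  intro M hM hc
  obtain ⟨k, _, hk⟩ := hM 0
  exact hav M hc ((prefix_pre_iff M r k).1 (g6.trans (g5 _ hk))).1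

/-! ### The construction and the final theorem -/

/-- The uniformly c.e. sequence given by a code. -/
def Vof (c : OracleCode) (i : ℕ) : Set (List Bool) :=
  {σ | (c.eval (chi fun _ => false) (Nat.pair i (Encodable.encode σ))).Dom}

/-- One step of the construction. -/
def StepRel (c : OracleCode) (C C' : Cond) : Prop :=
  C.κ <+: C'.κ ∧ C.κ.length < C'.κ.length ∧ C.r <+: C'.r ∧
      C.r.length < C'.r.length ∧ W C.e ⊆ W C'.e ∧ SL C'.L ⊆ SL C.L ∧
      (cantorMeasure (⋂ i, openOf (Vof c i)) = 0 → ∀ X ∈ N C'.e, X ∉ ⋂ i, openOf (Vof c i)) ∧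
      Req c (SL C'.L)

theorem exists_step (c : OracleCode) (C : Cond) : ∃ C', StepRel c C C' := by
  refine C.ext (fun e' => cantorMeasure (⋂ i, openOf (Vof c i)) = 0 →
    ∀ X ∈ N e', X ∉ ⋂ i, openOf (Vof c i)) (Req c) ?_ ?_
  · by_cases h : cantorMeasure (⋂ i, openOf (Vof c i)) = 0
    · obtain ⟨e', h1, h2, h3⟩ := w2r_step C.hgood ⟨c, fun i σ => Iff.rfl⟩ h
      exact ⟨e', h1, fun _ => h2, h3⟩
    · refine ⟨C.e, subset_rfl, fun h' => absurd h' h, le_trans ?_ C.hgood⟩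
      have : (0:ℝ) < (1/2)^C.a := by positivity
      linarith
  · intro ν hν
    exact sacks (SL_re C.L) C.perf hν c

theorem exists_cond : Nonempty Cond := by
  obtain ⟨e, he⟩ := exists_index (p := fun _ => False) (by
    have h : Computable₂ fun (_ : List Bool) (_ : ℕ) => false := Computable.const false
    exact (re_of_search (q := fun _ _ => false) h).of_eq fun σ => by simp)
  have hN : N e = Set.univ := Set.eq_univ_of_forall fun X n hn => (he _).1 hn
  have hS : ∀ σ, σ ∈ SL [] := fun σ n hn => by simp at hn
  refine ⟨⟨[], 0, e, [], 0, 0, [], ?_, le_refl _, fun τ _ _ => rfl, ?_, hS _,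
    fun σ _ => List.nil_prefix, by simp, fun τ _ _ => Or.inr (hS _), Or.inl rfl⟩⟩
  · unfold Good
    rw [hN, Set.univ_inter, muReal_cyl]; simp
  · intro ν _
    refine ⟨ν ++ [false], hS _, ν ++ [true], hS _, List.prefix_append _ _,
      List.prefix_append _ _, ?_, ?_⟩ <;>
    · intro h
      have := h.eq_of_length (by simp)
      simp at this

theorem encodeCode_inj : Function.Injective OracleCode.encodeCode := by
  intro c
  induction c with
  | zero => intro d h; cases d <;> simp [OracleCode.encodeCode] at h <;> first | rfl | omega
  | succ => intro d h; cases d <;> simp [OracleCode.encodeCode] at h <;> first | rfl | omega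
  | left => intro d h; cases d <;> simp [OracleCode.encodeCode] at h <;> first | rfl | omega
  | right => intro d h; cases d <;> simp [OracleCode.encodeCode] at h <;> first | rfl | omega
  | oracle => intro d h; cases d <;> simp [OracleCode.encodeCode] at h <;> first | rfl | omega
  | pair a b iha ihb =>
    intro d h
    cases d <;> simp only [OracleCode.encodeCode] at h <;> try omega
    rename_i x y
    have h1 := Nat.pair_eq_pair.1 (show Nat.pair a.encodeCode b.encodeCode =
      Nat.pair x.encodeCode y.encodeCode by omega)
    rw [iha h1.1, ihb h1.2]
  | comp a b iha ihb =>
    intro d h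
    cases d <;> simp only [OracleCode.encodeCode] at h <;> try omega
    rename_i x y
    have h1 := Nat.pair_eq_pair.1 (show Nat.pair a.encodeCode b.encodeCode =
      Nat.pair x.encodeCode y.encodeCode by omega)
    rw [iha h1.1, ihb h1.2]
  | prec a b iha ihb =>
    intro d h
    cases d <;> simp only [OracleCode.encodeCode] at h <;> try omega
    rename_i x y
    have h1 := Nat.pair_eq_pair.1 (show Nat.pair a.encodeCode b.encodeCode =
      Nat.pair x.encodeCode y.encodeCode by omega)
    rw [iha h1.1, ihb h1.2]
  | rfind' a iha =>
    intro d h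
    cases d <;> simp only [OracleCode.encodeCode] at h <;> try omega
    rename_i x
    have h1 := Nat.pair_eq_pair.1 (show Nat.pair a.encodeCode a.encodeCode =
      Nat.pair x.encodeCode x.encodeCode by omega)
    rw [iha h1.1]

theorem exists_seq : ∃ C : ℕ → Cond, ∃ f : ℕ → OracleCode, Function.Surjective f ∧
    ∀ j, StepRel (f j) (C j) (C (j+1)) := by
  have : Countable OracleCode := encodeCode_inj.countable
  have : Nonempty OracleCode := ⟨.zero⟩
  obtain ⟨f, hf⟩ := exists_surjective_nat OracleCode
  obtain ⟨C0⟩ := exists_cond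
  choose g hg using exists_step
  exact ⟨fun j => j.rec C0 fun i C => g (f i) C, f, hf, fun j => hg _ _⟩

theorem chain_limit (f : ℕ → List Bool) (h1 : ∀ j, f j <+: f (j+1))
    (h2 : ∀ j, (f j).length < (f (j+1)).length) :
    (∀ i j, i ≤ j → f i <+: f j) ∧ (∀ j, j ≤ (f j).length) ∧
      ∃ X, ∀ j, f j = pre X (f j).length := by
  have hm : ∀ i j, i ≤ j → f i <+: f j := by
    intro i j h
    induction j, h using Nat.le_induction with
    | base => exact List.prefix_refl _
    | succ n _ ih => exact ih.trans (h1 n)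
  have hl : ∀ j, j ≤ (f j).length := by
    intro j
    induction j with
    | zero => exact Nat.zero_le _
    | succ n ih => exact Nat.succ_le_of_lt (lt_of_le_of_lt ih (h2 n))
  refine ⟨hm, hl, fun n => (f (n+1)).getD n false, fun j => ?_⟩
  apply List.ext_getElem
  · simp
  · intro i h3 h4
    have h5 : i < (f (i+1)).length := hl (i+1)
    simp only [pre, List.getElem_map, List.getElem_range]
    rw [List.getD_eq_getElem _ _ h5]
    rcases le_total j (i+1) with h | h
    · exact (hm _ _ h).getElem h3
    · exact ((hm _ _ h).getElem h5).symm

theorem pre_mono_iff {X : ℕ → Bool} {σ : List Bool} (h : σ = pre X σ.length) {t : ℕ}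
    (ht : σ.length ≤ t) : σ <+: pre X t := (prefix_pre_iff X σ t).2 ⟨h, ht⟩

theorem F_reach (C : Cond) {A : ℕ → Bool} (hA : C.κ = pre A C.κ.length) :
    ∀ n ≤ C.r.length, ∃ s, n ≤ (F (pre A s)).length := by
  intro n
  induction n with
  | zero => exact fun _ => ⟨0, Nat.zero_le _⟩
  | succ n ih =>
    intro hn
    obtain ⟨s, hs⟩ := ih (by omega)
    obtain ⟨s0, hs0⟩ := SL_stage C.rmem
    let s' := max s (max s0 (max C.t C.κ.length))
    have e1 : s ≤ s' := le_max_left _ _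
    have e2 : s0 ≤ s' := le_trans (le_max_left _ _) (le_max_right _ _)
    have e3 : C.t ≤ s' := le_trans (le_max_left _ _)
      (le_trans (le_max_right _ _) (le_max_right _ _))
    have e4 : C.κ.length ≤ s' := le_trans (le_max_right _ _)
      (le_trans (le_max_right _ _) (le_max_right _ _))
    have hs' : n ≤ (F (pre A s')).length :=
      hs.trans (F_mono (pre_pfx A e1)).length_le
    by_cases hc : n + 1 ≤ (F (pre A s')).length
    · exact ⟨s', hc⟩
    have hpre : F (pre A s') <+: C.r := by
      rcases C.fn _ (pre_mono_iff hA e4) (by simpa using e3) with h | h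
      · exact h
      · have := (C.rle _ h).length_le; omega
    have hne : C.r ≠ F (pre A s') := by
      intro h; rw [← h] at hc; omega
    refine ⟨s'+1, ?_⟩
    rw [pre_succ, F_snoc, ← pre_succ, pre_length]
    have hL : C.L <+: (run (pre A (s'+1))).2.2.2 := by
      unfold run
      rw [pre_length]
      obtain ⟨d, hd⟩ := Nat.exists_eq_add_of_le (show C.K ≤ s'+1 from
        (C.hKt.trans e3).trans (Nat.le_succ _))
      have hk : (step (pre A (s'+1)))^[s'+1] init =
          (step (pre A (s'+1)))^[d] (C.κ.length, C.a, none, C.L) := by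
        rw [← C.dec (pre A (s'+1)) (pre_mono_iff hA (by omega)) (by simp; omega),
          ← Function.iterate_add_apply, show d + C.K = s'+1 by omega]
      rw [hk]
      exact iter_L_mono _ (C.κ.length, C.a, none, C.L) d
    rcases C.last with h | ⟨k, hk, hr⟩
    · rw [h] at hn; simp at hn
    · have hm := move_moves (σ := F (pre A s')) (L := (run (pre A (s'+1))).2.2.2) (s := s'+1)
        ⟨k, lt_of_lt_of_le hk hL.length_le, by
          rw [okM, getD_pfx hL hk, hr]
          refine ⟨hne, hpre, fun l hl => ?_⟩
          rw [getD_pfx hL (by omega)]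
          exact hs0 _ (by omega) _ (getD_mem (by omega))⟩
      omega

theorem main_construction : ∃ A : ℕ → Bool, Weak2Random A ∧
    ∃ M : ℕ → Bool, MinimalDeg M ∧ TRed M A := by
  obtain ⟨C, f, hf, hC⟩ := exists_seq
  obtain ⟨κm, κl, A, hA⟩ := chain_limit (fun j => (C j).κ) (fun j => (hC j).1)
    fun j => (hC j).2.1
  obtain ⟨rm, rl, M, hM⟩ := chain_limit (fun j => (C j).r) (fun j => (hC j).2.2.1)
    fun j => (hC j).2.2.2.1
  have hW : ∀ i j, i ≤ j → W (C i).e ⊆ W (C j).e := by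
    intro i j h
    induction j, h using Nat.le_induction with
    | base => exact subset_rfl
    | succ n _ ih => exact ih.trans (hC n).2.2.2.2.1
  have hSL : ∀ i j, i ≤ j → SL (C j).L ⊆ SL (C i).L := by
    intro i j h
    induction j, h using Nat.le_induction with
    | base => exact subset_rfl
    | succ n _ ih => exact (hC n).2.2.2.2.2.1.trans ih
  have hN : ∀ j, A ∈ N (C j).e := by
    intro j n hn
    obtain ⟨X, hX1, hX2⟩ := (C (max j n)).hgood.prefix_free
    have hl : n ≤ (C (max j n)).κ.length := (le_max_right j n).trans (κl _)
    refine hX1 n (hW j _ (le_max_left _ _) ?_)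
    rw [← pre_take X hl, ← mem_cyl.1 hX2, hA (max j n), pre_take A hl]
    exact hn
  have hMS : ∀ j n, ∃ k ≥ n, pre M k ∈ SL (C j).L := by
    intro j n
    refine ⟨(C (max j n)).r.length, (le_max_right j n).trans (rl _), ?_⟩
    rw [← hM (max j n)]
    exact hSL j _ (le_max_left _ _) (C (max j n)).rmem
  refine ⟨A, ?_, M, ⟨?_, ?_⟩, ?_⟩
  · rintro V ⟨c, hc⟩ h0
    obtain ⟨j, rfl⟩ := hf c
    have hV : V = Vof (f j) := by
      funext i; ext σ; exact hc i σ
    subst hV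
    exact (hC j).2.2.2.2.2.2.1 h0 A (hN (j+1))
  · rintro ⟨c, hc⟩
    obtain ⟨j, rfl⟩ := hf c
    exact (hC j).2.2.2.2.2.2.2.2 M (hMS (j+1)) hc
  · rintro Z ⟨c, hc⟩
    obtain ⟨j, rfl⟩ := hf c
    exact (hC j).2.2.2.2.2.2.2.1 M (hMS (j+1)) Z hc
  · refine TRed_of_list F F_prim.to_comp ?_ ?_
    · intro s i b hb
      have hi : i < (F (pre A s)).length := (List.getElem?_eq_some_iff.1 hb).1
      let j := i + 1
      let s' := max s (max (C j).t (C j).κ.length)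
      have hp : F (pre A s) <+: F (pre A s') := F_mono (pre_pfx A (le_max_left _ _))
      have hcomp : F (pre A s') <+: (C j).r ∨ (C j).r <+: F (pre A s') := by
        rcases (C j).fn (pre A s') (pre_mono_iff (hA j)
          (le_trans (le_max_right _ _) (le_max_right _ _)))
          (by rw [pre_length]; exact le_trans (le_max_left _ _) (le_max_right _ _)) with h | h
        · exact Or.inl h
        · exact Or.inr ((C j).rle _ h)
      have hcomp : F (pre A s) <+: (C j).r ∨ (C j).r <+: F (pre A s) := by
        rcases hcomp with h | h
        · exact Or.inl (hp.trans h)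
        · exact prefix_total hp h
      have hj : i < (C j).r.length := rl (i+1)
      have hr : (C j).r[i]? = some (M i) := by
        have := pre_getElem? M (C j).r.length i hj
        rwa [← hM j] at this
      rcases hcomp with h | h
      · have := h.getElem hi
        rw [List.getElem?_eq_getElem hi] at hb
        rw [List.getElem?_eq_getElem hj, ← this] at hr
        rw [hb] at hr
        simpa using hr.symm
      · have := h.getElem hj
        rw [List.getElem?_eq_getElem hi] at hb
        rw [List.getElem?_eq_getElem hj, this] at hr
        rw [hb] at hr
        simpa using hr.symm
    · intro n
      exact F_reach (C (n+1)) (hA (n+1)) (n+1) (rl (n+1))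

end Construction

/-- there is a weakly 2-random Turing degree which bounds a
minimal Turing degree. -/
theorem weak2Random_bounds_minimal :
    ∃ A : ℕ → Bool, Weak2Random A ∧ ∃ M : ℕ → Bool, MinimalDeg M ∧ TRed M A := by
  exact main_construction

end TypicalDegree
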